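/- For every η ∈ (0,1] there exist constants c₁'' > 0 and c₂'' > 0, depending only on η, with the following property. Let L ≠ ℚ be a number field, let β₁ be an exceptional real zero of ζ_L, i.e. a real zero of ζ_L in (0,1) with β₁ ≥ 1 − 1/(29.57(log d_L + n_L log 2)), and let β' ∈ (0,1) be a real zero of ζ_L with β' ≠ β₁. Then either β' ≤ 1 − η, or β' ≤ 1 − c₂'' · log( c₁'' / ((1 − β₁) · log d_L) ) / log d_L. -/

import Mathlib

section PartP1
open MeasureTheory
open scoped ENNReal
namespace DH

lemma tsum_pi_fin {α : Type*} (g : α → ℝ≥0∞) (n : ℕ) :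
    ∑' f : Fin n → α, ∏ i, g (f i) = (∑' a, g a) ^ n := by
  induction n with
  | zero => simp
  | succ n ih =>
    rw [← (Fin.consEquiv (fun _ => α)).tsum_eq, ENNReal.tsum_prod', pow_succ', ← ih,
      ← ENNReal.tsum_mul_right]
    refine tsum_congr fun a => ?_
    rw [← ENNReal.tsum_mul_left]
    refine tsum_congr fun f => ?_
    simp [Fin.consEquiv, Fin.prod_univ_succ]

lemma tsum_pi {α ι : Type*} [Fintype ι] (g : α → ℝ≥0∞) :
    ∑' f : ι → α, ∏ i, g (f i) = (∑' a, g a) ^ (Fintype.card ι) := by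
  rw [← tsum_pi_fin, ← ((Fintype.equivFin ι).arrowCongr (Equiv.refl α)).symm.tsum_eq]
  refine tsum_congr fun f => ?_
  simp only [Equiv.arrowCongr_symm, Equiv.arrowCongr_apply, Equiv.refl_symm, Equiv.coe_refl, Function.comp, id]
  exact (Fintype.equivFin ι).symm.symm.prod_comp (fun i => g (f i)) 

lemma summable_gauss_int (c : ℝ) (hc : 0 < c) : Summable fun k : ℤ => Real.exp (-c * (k:ℝ)^2) := by
  have key : Summable fun n : ℕ => Real.exp (-c * (n:ℝ)^2) := by
    refine Summable.of_nonneg_of_le (fun n => (Real.exp_pos _).le) (fun n => ?_)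
      (summable_geometric_of_lt_one (Real.exp_pos (-c)).le (by simpa using hc))
    rw [← Real.exp_nat_mul]
    apply Real.exp_le_exp.mpr
    have : (n:ℝ) ≤ (n:ℝ)^2 := by exact_mod_cast Nat.le_self_pow two_ne_zero n
    nlinarith
  refine Summable.of_nat_of_neg (by simpa using key) (by simpa using key)

lemma summable_gauss_pi {ι : Type*} [Fintype ι] (c : ℝ) (hc : 0 < c) :
    Summable fun k : ι → ℤ => Real.exp (-c * ∑ i, (k i:ℝ)^2) := by
  have h := tsum_pi (ι := ι) (fun k : ℤ => ENNReal.ofReal (Real.exp (-c * (k:ℝ)^2)))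
  have h2 : ∑' k : ℤ, ENNReal.ofReal (Real.exp (-c * (k:ℝ)^2)) ≠ ⊤ :=
    (summable_gauss_int c hc).tsum_ofReal_ne_top
  have h3 : ∑' f : ι → ℤ, ENNReal.ofReal (Real.exp (-c * ∑ i, (f i:ℝ)^2)) ≠ ⊤ := by
    have : ∀ f : ι → ℤ, ENNReal.ofReal (Real.exp (-c * ∑ i, (f i:ℝ)^2)) = ∏ i, ENNReal.ofReal (Real.exp (-c * (f i:ℝ)^2)) := by
      intro f
      rw [← ENNReal.ofReal_prod_of_nonneg (fun i _ => (Real.exp_pos _).le), ← Real.exp_sum, Finset.mul_sum]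
    simp_rw [this, h]
    exact ENNReal.pow_ne_top h2
  have := ENNReal.summable_toReal h3
  refine this.congr fun k => ?_
  rw [ENNReal.toReal_ofReal (Real.exp_pos _).le]

end DH
end PartP1

section PartP2
open MeasureTheory Set
open scoped ENNReal
namespace DH

variable {ι : Type*} [Fintype ι]

/-- integer vector as a real vector -/
def toR (k : ι → ℤ) : ι → ℝ := fun i => (k i : ℝ)

/-- half-open unit cube -/
def cube (ι : Type*) : Set (ι → ℝ) := {x | ∀ i, x i ∈ Ioc (0:ℝ) (0+1)}

lemma measurableSet_cube : MeasurableSet (cube ι) :=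
  MeasurableSet.univ_pi' (fun _ => measurableSet_Ioc)

lemma gauss_shift_bound {f : (ι → ℝ) → ℂ} {C c : ℝ} (hC : 0 ≤ C) (hc : 0 < c)
    (hf : ∀ x, ‖f x‖ ≤ C * Real.exp (-c * ∑ i, (x i)^2)) (R : ℝ)
    (x : ι → ℝ) (hx : ∑ i, (x i)^2 ≤ R) (k : ι → ℤ) :
    ‖f (x + toR k)‖ ≤ C * Real.exp (c * R) * Real.exp (-(c/2) * ∑ i, (k i : ℝ)^2) := by
  refine (hf _).trans ?_
  rw [mul_assoc, ← Real.exp_add]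
  refine mul_le_mul_of_nonneg_left (Real.exp_le_exp.mpr ?_) hC
  have h : ∑ i, (k i : ℝ)^2 ≤ 2 * ∑ i, ((x + toR k) i)^2 + 2 * ∑ i, (x i)^2 := by
    rw [Finset.mul_sum, Finset.mul_sum, ← Finset.sum_add_distrib]
    refine Finset.sum_le_sum fun i _ => ?_
    simp only [Pi.add_apply, toR]
    nlinarith [sq_nonneg (2 * x i + k i)]
  nlinarith

lemma continuous_periodization {f : (ι → ℝ) → ℂ} (hcont : Continuous f) {C c : ℝ} (hC : 0 ≤ C)
    (hc : 0 < c) (hf : ∀ x, ‖f x‖ ≤ C * Real.exp (-c * ∑ i, (x i)^2)) :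
    Continuous fun x => ∑' k : ι → ℤ, f (x + toR k) := by
  rw [continuous_iff_continuousAt]
  intro x
  set R := ∑ i, (x i)^2 + 1
  have hopen : IsOpen {y : ι → ℝ | ∑ i, (y i)^2 < R} := isOpen_lt (by fun_prop) continuous_const
  have h : ContinuousOn (fun x => ∑' k : ι → ℤ, f (x + toR k)) {y : ι → ℝ | ∑ i, (y i)^2 < R} := by
    refine continuousOn_tsum (u := fun k => C * Real.exp (c * R) * Real.exp (-(c/2) * ∑ i, (k i : ℝ)^2))
      (fun k => (hcont.comp (by fun_prop)).continuousOn) ((summable_gauss_pi (c/2) (by linarith)).mul_left _) ?_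
    intro k y hy
    exact gauss_shift_bound hC hc hf R y (le_of_lt hy) k
  exact h.continuousAt (hopen.mem_nhds (by simp [R]))

lemma integrable_gauss_bound {f : (ι → ℝ) → ℂ} (hcont : Continuous f) {C c : ℝ}
    (hc : 0 < c) (hf : ∀ x, ‖f x‖ ≤ C * Real.exp (-c * ∑ i, (x i)^2)) : Integrable f := by
  have h := GaussianFourier.integrable_cexp_neg_mul_sum_add (ι := ι) (b := (c:ℂ)) (by simpa using hc) 0
  refine Integrable.mono' (h.norm.const_mul C) hcont.aestronglyMeasurable (ae_of_all _ fun x => ?_)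
  refine (hf x).trans (le_of_eq ?_)
  rw [Complex.norm_exp]
  congr 2
  have : (-(c:ℂ) * ∑ i, (x i : ℂ)^2 + ∑ i, (0 : ι → ℂ) i * x i) = ((-c * ∑ i, (x i)^2 : ℝ) : ℂ) := by
    push_cast; simp
  rw [this, Complex.ofReal_re]

/-- unfolding the integral over the cube -/
lemma integral_cube_tsum {g : (ι → ℝ) → ℂ} (hcont : Continuous g) {C c : ℝ} (hC : 0 ≤ C)
    (hc : 0 < c) (hf : ∀ x, ‖g x‖ ≤ C * Real.exp (-c * ∑ i, (x i)^2)) :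
    ∫ x in cube ι, ∑' k : ι → ℤ, g (x + toR k) = ∫ x, g x := by
  have hgint : Integrable g := integrable_gauss_bound hcont hc hf
  set S : (ι → ℤ) → Set (ι → ℝ) := fun k => {x | x - toR k ∈ cube ι} with hS
  have hSm : ∀ k, MeasurableSet (S k) := fun k => measurableSet_cube.preimage (by fun_prop)
  have hdisj : Pairwise (Function.onFun Disjoint S) := by
    intro k l hkl
    rw [Function.onFun, Set.disjoint_left]
    intro x hx hy
    apply hkl
    ext i
    have h1 := hx i
    have h2 := hy i
    simp only [Pi.sub_apply, toR, mem_Ioc] at h1 h2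
    have a : ((k i : ℤ) : ℝ) < l i + 1 := by linarith
    have b : ((l i : ℤ) : ℝ) < k i + 1 := by linarith
    norm_cast at a b
    omega
  have hun : (⋃ k, S k) = univ := by
    rw [eq_univ_iff_forall]
    intro x
    rw [mem_iUnion]
    refine ⟨fun i => ⌈x i⌉ - 1, fun i => ?_⟩
    simp only [Pi.sub_apply, toR, mem_Ioc]
    push_cast
    constructor <;> linarith [Int.le_ceil (x i), Int.ceil_lt_add_one (x i)]
  have h1 : ∫ x, g x = ∑' k, ∫ x in S k, g x := by
    rw [← setIntegral_univ, ← hun]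
    exact integral_iUnion hSm hdisj hgint.integrableOn
  have h2 : ∀ k, ∫ x in S k, g x = ∫ x in cube ι, g (x + toR k) := by
    intro k
    have hmp : MeasurePreserving (fun x : ι → ℝ => x + toR k) := measurePreserving_add_right volume (toR k)
    rw [← hmp.setIntegral_preimage_emb (MeasurableEquiv.addRight (toR k)).measurableEmbedding]
    congr 2
    ext x; simp [hS]
  have hcube : volume (cube ι) ≠ ⊤ := by
    have : cube ι = Set.univ.pi fun _ => Ioc (0:ℝ) (0+1) := by ext; simp [cube]
    rw [this, Real.volume_pi_Ioc]; simp
  rw [h1]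
  simp_rw [h2]
  have hb : ∀ k : ι → ℤ, ∀ x ∈ cube ι, ‖g (x + toR k)‖ ≤
      C * Real.exp (c * Fintype.card ι) * Real.exp (-(c/2) * ∑ i, (k i : ℝ)^2) := by
    intro k x hx
    refine gauss_shift_bound hC hc hf _ x ?_ k
    calc ∑ i, (x i)^2 ≤ ∑ i : ι, (1:ℝ) := Finset.sum_le_sum fun i _ => by
          have := hx i; simp only [mem_Ioc] at this; nlinarith
      _ = _ := by simp
  symm
  have hI : ∀ k : ι → ℤ, IntegrableOn (fun x => g (x + toR k)) (cube ι) := fun k =>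
    (hgint.comp_add_right (toR k)).integrableOn
  refine (hasSum_integral_of_summable_integral_norm hI ?_).tsum_eq
  refine Summable.of_nonneg_of_le (fun k => integral_nonneg fun x => norm_nonneg _) (fun k => ?_)
    (((summable_gauss_pi (ι := ι) (c/2) (by linarith)).mul_left (C * Real.exp (c * Fintype.card ι))).mul_right (volume.real (cube ι)))
  calc ∫ x in cube ι, ‖g (x + toR k)‖ ≤ ‖∫ x in cube ι, ‖g (x + toR k)‖‖ := le_abs_self _
    _ ≤ _ := norm_setIntegral_le_of_norm_le_const hcube.lt_top (fun x hx => by simpa using hb k x hx)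

theorem poisson {f : (ι → ℝ) → ℂ} (hcont : Continuous f) {C c : ℝ} (hC : 0 ≤ C)
    (hc : 0 < c) (hf : ∀ x, ‖f x‖ ≤ C * Real.exp (-c * ∑ i, (x i)^2))
    (hsum : Summable fun k : ι → ℤ => ∫ x : ι → ℝ, Complex.exp (-2 * Real.pi * Complex.I * ∑ i, (k i : ℂ) * x i) * f x) :
    ∑' k : ι → ℤ, f (toR k) =
      ∑' k : ι → ℤ, ∫ x : ι → ℝ, Complex.exp (-2 * Real.pi * Complex.I * ∑ i, (k i : ℂ) * x i) * f x := by
  set P : (ι → ℝ) → ℂ := fun x => ∑' k : ι → ℤ, f (x + toR k) with hP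
  have hPc : Continuous P := continuous_periodization hcont hC hc hf
  have hper : ∀ x (l : ι → ℤ), P (x + toR l) = P x := by
    intro x l
    simp only [hP]
    rw [← (Equiv.addLeft l).tsum_eq (fun k => f (x + toR k))]
    refine tsum_congr fun k => ?_
    congr 1
    ext i; simp [toR, add_assoc]
  let mk : (ι → ℝ) → UnitAddTorus ι := fun x i => (x i : UnitAddCircle)
  have hmk : IsOpenQuotientMap mk :=
    IsOpenQuotientMap.piMap (fun _ : ι => (QuotientAddGroup.isOpenQuotientMap_mk : IsOpenQuotientMap (QuotientAddGroup.mk : ℝ → UnitAddCircle)))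
  have hfac : ∀ x y, mk x = mk y → P x = P y := by
    intro x y hxy
    have : ∀ i, ∃ n : ℤ, y i - x i = n := by
      intro i
      have h := congrFun hxy i
      simp only [mk] at h
      have h := QuotientAddGroup.eq.mp h
      obtain ⟨n, hn⟩ := AddSubgroup.mem_zmultiples_iff.mp h
      refine ⟨n, ?_⟩
      simp only [zsmul_eq_mul, mul_one] at hn
      rw [hn]; ring
    choose l hl using this
    have : y = x + toR l := by ext i; simp [toR, ← hl]
    rw [this, hper]
  let Q : C(UnitAddTorus ι, ℂ) := ⟨fun t => P (Function.surjInv hmk.surjective t), by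
    rw [← hmk.continuous_comp_iff]
    refine hPc.congr fun x => ?_
    exact hfac _ _ (Function.surjInv_eq hmk.surjective (mk x)).symm⟩
  have hQ : ∀ x, Q (mk x) = P x := fun x => hfac _ _ (Function.surjInv_eq hmk.surjective (mk x))
  have hmF : ∀ (k : ι → ℤ) (x : ι → ℝ), UnitAddTorus.mFourier (-k) (mk x) =
      Complex.exp (-2 * Real.pi * Complex.I * ∑ i, (k i : ℂ) * x i) := by
    intro k x
    simp only [UnitAddTorus.mFourier, ContinuousMap.coe_mk, mk, Pi.neg_apply]
    rw [Finset.mul_sum, Complex.exp_sum]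
    refine Finset.prod_congr rfl fun i _ => ?_
    rw [fourier_coe_apply]
    congr 1
    push_cast; ring
  have hcoef : ∀ k, UnitAddTorus.mFourierCoeff Q k =
      ∫ x : ι → ℝ, Complex.exp (-2 * Real.pi * Complex.I * ∑ i, (k i : ℂ) * x i) * f x := by
    intro k
    rw [UnitAddTorus.mFourierCoeff_eq_integral Q k 0]
    rw [← integral_cube_tsum (g := fun x => Complex.exp (-2 * Real.pi * Complex.I * ∑ i, (k i : ℂ) * x i) * f x) (by fun_prop) hC hc]
    · have : {x : ι → ℝ | ∀ i, x i ∈ Ioc ((0 : ι → ℝ) i) ((0 : ι → ℝ) i + 1)} = cube ι := by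
        ext; simp [cube]
      rw [this]
      refine integral_congr_ae (ae_of_all _ fun x => ?_)
      change UnitAddTorus.mFourier (-k) (mk x) • Q (mk x) = _
      rw [hQ, hmF, smul_eq_mul, hP, ← tsum_mul_left]
      refine tsum_congr fun l => ?_
      congr 1
      have : (-2 * Real.pi * Complex.I * ∑ i, (k i : ℂ) * ((x + toR l) i : ℝ)) =
          -2 * Real.pi * Complex.I * (∑ i, (k i : ℂ) * x i) + ((-∑ i, k i * l i : ℤ) : ℂ) * (2 * Real.pi * Complex.I) := by
        simp only [Pi.add_apply, toR]
        push_cast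
        simp only [mul_add, Finset.sum_add_distrib]
        ring
      rw [this, Complex.exp_add, Complex.exp_int_mul_two_pi_mul_I, mul_one]
    · intro x
      rw [norm_mul]
      have : ‖Complex.exp (-2 * Real.pi * Complex.I * ∑ i, (k i : ℂ) * x i)‖ = 1 := by
        rw [show (-2 * Real.pi * Complex.I * ∑ i, (k i : ℂ) * x i) = ((-2 * Real.pi * ∑ i, (k i : ℝ) * x i : ℝ) : ℂ) * Complex.I by push_cast; ring]
        exact Complex.norm_exp_ofReal_mul_I _
      rw [this, one_mul]
      exact hf x
  have hs : Summable (UnitAddTorus.mFourierCoeff Q) := by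
    refine hsum.congr fun k => (hcoef k).symm
  have h0 := UnitAddTorus.hasSum_mFourier_series_apply_of_summable hs (mk 0)
  rw [hQ] at h0
  have hm0 : ∀ k : ι → ℤ, UnitAddTorus.mFourier k (mk 0) = 1 := by
    intro k
    have := hmF (-k) 0
    simpa using this
  simp only [hm0, hcoef, smul_eq_mul, mul_one] at h0
  rw [h0.tsum_eq, hP]
  simp
end DH
end PartP2

section PartP3
open MeasureTheory Set
open scoped ENNReal Matrix
namespace DH

variable {ι : Type*} [Fintype ι] [DecidableEq ι]

open scoped MatrixOrder in
lemma posDef_factor (G : Matrix ι ι ℝ) (hG : G.PosDef) : ∃ M : Matrix ι ι ℝ, IsUnit M ∧ G = Mᵀ * M := by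
  obtain ⟨M, h1, h2⟩ := CStarAlgebra.isStrictlyPositive_iff_eq_star_mul_self.mp hG.isStrictlyPositive
  refine ⟨M, h1, ?_⟩
  rw [h2, Matrix.star_eq_conjTranspose, Matrix.conjTranspose_eq_transpose_of_trivial]

lemma gauss_ft (M : Matrix ι ι ℝ) (hM : IsUnit M.det) (k : ι → ℝ) :
    ∫ x : ι → ℝ, Complex.exp (-2 * Real.pi * Complex.I * ∑ i, (k i : ℂ) * x i) *
      Complex.exp (-Real.pi * ∑ i, ((M *ᵥ x) i : ℂ)^2) =
    (|M.det|⁻¹ : ℝ) * Complex.exp (-Real.pi * ∑ i, (((M⁻¹)ᵀ *ᵥ k) i : ℂ)^2) := by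
  have hdet : M.det ≠ 0 := hM.ne_zero
  set g : (ι → ℝ) → ℂ := fun y => Complex.exp (-Real.pi * ∑ i, (y i : ℂ)^2 + ∑ i, (-2 * Real.pi * Complex.I * (((M⁻¹)ᵀ *ᵥ k) i : ℝ)) * y i) with hg
  have hmap := Real.map_matrix_volume_pi_eq_smul_volume_pi hdet
  have h1 : ∀ x : ι → ℝ, Complex.exp (-2 * Real.pi * Complex.I * ∑ i, (k i : ℂ) * x i) *
      Complex.exp (-Real.pi * ∑ i, ((M *ᵥ x) i : ℂ)^2) = g (Matrix.toLin' M x) := by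
    intro x
    rw [hg, ← Complex.exp_add]
    congr 1
    rw [Matrix.toLin'_apply, add_comm]
    congr 1
    have : ∑ i, k i * x i = ∑ i, ((M⁻¹)ᵀ *ᵥ k) i * (M *ᵥ x) i := by
      change k ⬝ᵥ x = ((M⁻¹)ᵀ *ᵥ k) ⬝ᵥ (M *ᵥ x)
      rw [Matrix.mulVec_transpose, ← Matrix.dotProduct_mulVec, Matrix.mulVec_mulVec, Matrix.nonsing_inv_mul _ hM, Matrix.one_mulVec]
    have h2 := congrArg (fun r : ℝ => (r : ℂ)) this
    push_cast at h2
    rw [h2, Finset.mul_sum]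
    refine Finset.sum_congr rfl fun i _ => by ring
  simp_rw [h1]
  have hemb : MeasurableEmbedding (Matrix.toLin' M) := by
    have : Function.Injective (Matrix.toLin' M) := by
      intro x y hxy
      simp only [Matrix.toLin'_apply] at hxy
      have := congrArg (fun v => M⁻¹ *ᵥ v) hxy
      simpa [Matrix.mulVec_mulVec, Matrix.nonsing_inv_mul _ hM] using this
    exact (LinearMap.continuous_of_finiteDimensional _).measurableEmbedding this
  rw [← hemb.integral_map (μ := volume) g, hmap, integral_smul_measure, hg]
  rw [GaussianFourier.integral_cexp_neg_mul_sum_add (b := (Real.pi : ℂ)) (by simpa using Real.pi_pos)]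
  have hpi : (Real.pi : ℂ) ≠ 0 := by exact_mod_cast Real.pi_ne_zero
  rw [div_self hpi, Complex.one_cpow, one_mul, ENNReal.toReal_ofReal (abs_nonneg _), abs_inv]
  rw [Complex.real_smul]
  congr 2
  rw [Finset.sum_div, Finset.mul_sum]
  refine Finset.sum_congr rfl fun i _ => ?_
  field_simp
  ring_nf
  rw [Complex.I_sq]; ring

lemma mulVec_lower (M : Matrix ι ι ℝ) (hM : IsUnit M.det) : ∃ c : ℝ, 0 < c ∧
    ∀ x : ι → ℝ, c * ∑ i, (x i)^2 ≤ ∑ i, ((M *ᵥ x) i)^2 := by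
  set N : ℝ := ∑ i, ∑ j, (M⁻¹ i j)^2 + 1
  have hN : 0 < N := by positivity
  refine ⟨N⁻¹, by positivity, fun x => ?_⟩
  rw [inv_mul_le_iff₀ hN]
  set y := M *ᵥ x with hy
  have hx : x = M⁻¹ *ᵥ y := by rw [hy, Matrix.mulVec_mulVec, Matrix.nonsing_inv_mul _ hM, Matrix.one_mulVec]
  have hnn : 0 ≤ ∑ i, (y i)^2 := by positivity
  calc ∑ i, (x i)^2 ≤ ∑ i, (∑ j, (M⁻¹ i j)^2) * ∑ j, (y j)^2 := by
        refine Finset.sum_le_sum fun i _ => ?_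
        rw [hx]
        exact Finset.sum_mul_sq_le_sq_mul_sq _ _ _
    _ ≤ _ := by
        rw [← Finset.sum_mul]
        exact mul_le_mul_of_nonneg_right (by simp [N]) hnn

theorem poisson_M (M : Matrix ι ι ℝ) (hM : IsUnit M.det) :
    ∑' k : ι → ℤ, ENNReal.ofReal (Real.exp (-Real.pi * ∑ i, ((M *ᵥ toR k) i)^2)) =
    ENNReal.ofReal (|M.det|⁻¹) * ∑' k : ι → ℤ, ENNReal.ofReal (Real.exp (-Real.pi * ∑ i, (((M⁻¹)ᵀ *ᵥ toR k) i)^2)) := by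
  have hsumm : ∀ M : Matrix ι ι ℝ, IsUnit M.det → Summable fun k : ι → ℤ => Real.exp (-Real.pi * ∑ i, ((M *ᵥ toR k) i)^2) := by
    intro M hM
    obtain ⟨c, hc, h⟩ := mulVec_lower M hM
    refine Summable.of_nonneg_of_le (fun k => (Real.exp_pos _).le) (fun k => ?_) (summable_gauss_pi (ι := ι) (Real.pi * c) (by positivity))
    apply Real.exp_le_exp.mpr
    have := h (toR k)
    simp only [toR] at this ⊢
    nlinarith [Real.pi_pos]
  have hM' : IsUnit ((M⁻¹)ᵀ).det := by
    rw [Matrix.det_transpose]; exact Matrix.isUnit_nonsing_inv_det M hM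
  obtain ⟨c, hc, h⟩ := mulVec_lower M hM
  have hft := gauss_ft M hM
  have hcast : ∀ (N : Matrix ι ι ℝ) (x : ι → ℝ), Complex.exp (-Real.pi * ∑ i, ((N *ᵥ x) i : ℂ)^2) =
      ((Real.exp (-Real.pi * ∑ i, ((N *ᵥ x) i)^2) : ℝ) : ℂ) := by
    intro N x; push_cast; rfl
  have hS2 : Summable fun k : ι → ℤ => ∫ x : ι → ℝ, Complex.exp (-2 * Real.pi * Complex.I * ∑ i, (k i : ℂ) * x i) *
      Complex.exp (-Real.pi * ∑ i, ((M *ᵥ x) i : ℂ)^2) := by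
    have e : ∀ k : ι → ℤ, _ = _ := fun k => hft (toR k)
    simp only [toR, Complex.ofReal_intCast] at e
    simp_rw [e, hcast]
    refine Summable.mul_left _ ?_
    exact_mod_cast hsumm _ hM'
  have hp := poisson (f := fun x : ι → ℝ => Complex.exp (-Real.pi * ∑ i, ((M *ᵥ x) i : ℂ)^2)) (by
      simp_rw [hcast]
      have : Continuous fun x : ι → ℝ => M *ᵥ x := by fun_prop
      fun_prop) (C := 1) zero_le_one (c := Real.pi * c) (by positivity) (fun x => by
      rw [hcast, Complex.norm_real, Real.norm_of_nonneg (Real.exp_pos _).le, one_mul]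
      apply Real.exp_le_exp.mpr
      have := h x
      nlinarith [Real.pi_pos]) hS2
  have e : ∀ k : ι → ℤ, _ = _ := fun k => hft (toR k)
  simp only [toR, Complex.ofReal_intCast] at e
  simp_rw [e, hcast] at hp
  rw [← ENNReal.ofReal_tsum_of_nonneg (fun k => (Real.exp_pos _).le) (hsumm M hM),
    ← ENNReal.ofReal_tsum_of_nonneg (fun k => (Real.exp_pos _).le) (hsumm _ hM'),
    ← ENNReal.ofReal_mul (by positivity)]
  congr 1
  rw [tsum_mul_left] at hp
  exact_mod_cast hp

theorem poisson_G (G : Matrix ι ι ℝ) (hG : G.PosDef) :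
    ∑' k : ι → ℤ, ENNReal.ofReal (Real.exp (-Real.pi * (toR k ⬝ᵥ G *ᵥ toR k))) =
    ENNReal.ofReal ((√G.det)⁻¹) * ∑' k : ι → ℤ, ENNReal.ofReal (Real.exp (-Real.pi * (toR k ⬝ᵥ G⁻¹ *ᵥ toR k))) := by
  obtain ⟨M, hM, rfl⟩ := posDef_factor G hG
  have hM' : IsUnit M.det := (Matrix.isUnit_iff_isUnit_det _).mp hM
  have h1 : ∀ (N : Matrix ι ι ℝ) x, x ⬝ᵥ (Nᵀ * N) *ᵥ x = ∑ i, ((N *ᵥ x) i)^2 := by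
    intro N x
    rw [← Matrix.mulVec_mulVec, Matrix.dotProduct_mulVec, Matrix.vecMul_transpose]
    simp [dotProduct, sq]
  have h2 : (Mᵀ * M)⁻¹ = ((M⁻¹)ᵀ)ᵀ * (M⁻¹)ᵀ := by
    rw [Matrix.mul_inv_rev, Matrix.transpose_transpose, Matrix.transpose_nonsing_inv]
  have h3 : √(Mᵀ * M).det = |M.det| := by
    rw [Matrix.det_mul, Matrix.det_transpose, Real.sqrt_mul_self_eq_abs]
  rw [h2, h3]
  simp_rw [h1]
  exact poisson_M M hM'
end DH
end PartP3

section PartP4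
open MeasureTheory Set NumberField
open scoped ENNReal Matrix nonZeroDivisors
set_option linter.unusedSectionVars false
namespace DH

variable {K : Type*} [Field K] [NumberField K]

/-- weighted sum of coordinates -/
noncomputable def ell (u : InfinitePlace K → ℝ) : ℝ := ∑ v, (v.mult : ℝ) * u v
/-- the quadratic form -/
noncomputable def qf (u : InfinitePlace K → ℝ) (x : K) : ℝ :=
  ∑ v : InfinitePlace K, (v.mult : ℝ) * (Real.exp (2 * u v) * (v x)^2)

lemma sum_emb (f : InfinitePlace K → ℝ) :
    ∑ σ : K →ₐ[ℚ] ℂ, f (InfinitePlace.mk σ.toRingHom) = ∑ v, (v.mult : ℝ) * f v := by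
  classical
  have h1 : ∑ σ : K →ₐ[ℚ] ℂ, f (InfinitePlace.mk σ.toRingHom) = ∑ φ : K →+* ℂ, f (InfinitePlace.mk φ) :=
    Fintype.sum_equiv (RingHom.equivRatAlgHom (R := K) (S := ℂ)).symm _ _ (fun σ => rfl)
  rw [h1, ← Finset.sum_fiberwise_of_maps_to (s := Finset.univ) (t := Finset.univ) (g := InfinitePlace.mk) (by simp)]
  refine Finset.sum_congr rfl fun v _ => ?_
  rw [Finset.sum_congr rfl (g := fun _ => f v), Finset.sum_const, InfinitePlace.card_filter_mk_eq, nsmul_eq_mul]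
  intro φ hφ
  rw [(Finset.mem_filter.mp hφ).2]

/-- conjugate embedding -/
noncomputable def cj : (K →ₐ[ℚ] ℂ) ≃ (K →ₐ[ℚ] ℂ) :=
  Function.Involutive.toPerm (fun σ => (Complex.conjAe.restrictScalars ℚ).toAlgHom.comp σ)
    (fun σ => by ext x; simp)

lemma cj_apply (σ : K →ₐ[ℚ] ℂ) (x : K) : cj σ x = (starRingEnd ℂ) (σ x) := by
  simp [cj]
lemma mk_cj (σ : K →ₐ[ℚ] ℂ) : InfinitePlace.mk (cj σ).toRingHom = InfinitePlace.mk σ.toRingHom := by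
  rw [← InfinitePlace.mk_conjugate_eq]
  congr 1
  ext x
  simp [cj]

variable {ι : Type*} [Fintype ι] [DecidableEq ι]

/-- Gram matrix -/
noncomputable def gram (u : InfinitePlace K → ℝ) (b : ι → K) : Matrix ι ι ℝ :=
  fun i j => ∑ σ : K →ₐ[ℚ] ℂ, Real.exp (2 * u (InfinitePlace.mk σ.toRingHom)) * (σ (b i) * (starRingEnd ℂ) (σ (b j))).re

lemma gram_cast (u : InfinitePlace K → ℝ) (b : ι → K) (i j : ι) : ((gram u b i j : ℝ) : ℂ) =
    ∑ σ : K →ₐ[ℚ] ℂ, (Real.exp (2 * u (InfinitePlace.mk σ.toRingHom)) : ℂ) * (σ (b i) * (starRingEnd ℂ) (σ (b j))) := by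
  set S := ∑ σ : K →ₐ[ℚ] ℂ, (Real.exp (2 * u (InfinitePlace.mk σ.toRingHom)) : ℂ) * (σ (b i) * (starRingEnd ℂ) (σ (b j))) with hS
  have h1 : (starRingEnd ℂ) S = S := by
    rw [hS, map_sum]
    refine Fintype.sum_equiv cj _ _ fun σ => ?_
    rw [mk_cj, cj_apply, cj_apply, map_mul, map_mul, Complex.conj_ofReal]
  have h2 : S.re = gram u b i j := by
    rw [hS, gram, Complex.re_sum]
    exact Finset.sum_congr rfl fun σ _ => by rw [Complex.re_ofReal_mul]
  rw [← h2]
  exact Complex.conj_eq_iff_re.mp h1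

lemma gram_quad (u : InfinitePlace K → ℝ) (b : ι → K) (x : ι → ℝ) :
    x ⬝ᵥ gram u b *ᵥ x = ∑ σ : K →ₐ[ℚ] ℂ, Real.exp (2 * u (InfinitePlace.mk σ.toRingHom)) * ‖∑ i, (x i : ℂ) * σ (b i)‖^2 := by
  have h : ∀ σ : K →ₐ[ℚ] ℂ, ‖∑ i, (x i : ℂ) * σ (b i)‖^2 = ∑ i, ∑ j, x i * x j * (σ (b i) * (starRingEnd ℂ) (σ (b j))).re := by
    intro σ
    have h3 : ((‖∑ i, (x i : ℂ) * σ (b i)‖^2 : ℝ) : ℂ) = ∑ i, ∑ j, ((x i * x j : ℝ) : ℂ) * (σ (b i) * (starRingEnd ℂ) (σ (b j))) := by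
      push_cast
      rw [← Complex.mul_conj', map_sum, Finset.sum_mul_sum]
      refine Finset.sum_congr rfl fun i _ => Finset.sum_congr rfl fun j _ => ?_
      rw [map_mul, Complex.conj_ofReal]; ring
    have := congrArg Complex.re h3
    rw [Complex.ofReal_re] at this
    rw [this, Complex.re_sum]
    refine Finset.sum_congr rfl fun i _ => ?_
    rw [Complex.re_sum]
    refine Finset.sum_congr rfl fun j _ => ?_
    rw [Complex.re_ofReal_mul]
  simp_rw [h, dotProduct, Matrix.mulVec, dotProduct, gram, Finset.mul_sum, Finset.sum_mul]
  simp_rw [Finset.mul_sum]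
  rw [Finset.sum_comm' (t' := Finset.univ) (s' := fun _ => Finset.univ) (by simp)]
  simp_rw [Finset.sum_comm (s := (Finset.univ : Finset ι)) (t := (Finset.univ : Finset (K →ₐ[ℚ] ℂ)))]
  refine Finset.sum_congr rfl fun σ _ => ?_
  rw [Finset.sum_comm]
  refine Finset.sum_congr rfl fun i _ => Finset.sum_congr rfl fun j _ => ?_
  ring

lemma gram_quad_int (u : InfinitePlace K → ℝ) (b : ι → K) (k : ι → ℤ) :
    toR k ⬝ᵥ gram u b *ᵥ toR k = qf u (∑ i, k i • b i) := by
  rw [gram_quad, qf, ← sum_emb (fun v => Real.exp (2 * u v) * (v (∑ i, k i • b i))^2)]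
  refine Finset.sum_congr rfl fun σ _ => ?_
  congr 2
  rw [InfinitePlace.apply]
  congr 1
  simp [toR]

end DH
end PartP4

section PartP4b
open MeasureTheory Set NumberField
open scoped ENNReal Matrix nonZeroDivisors
set_option linter.unusedSectionVars false
namespace DH

variable {K : Type*} [Field K] [NumberField K]
variable {ι : Type*} [Fintype ι] [DecidableEq ι]

lemma exists_emb_equiv (b : Module.Basis ι ℚ K) : Nonempty (ι ≃ (K →ₐ[ℚ] ℂ)) := by
  refine ⟨Fintype.equivOfCardEq ?_⟩
  rw [AlgHom.card, Module.finrank_eq_card_basis b]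

lemma gram_map (u : InfinitePlace K → ℝ) (b : ι → K) (e : ι ≃ (K →ₐ[ℚ] ℂ)) :
    (gram u b).map (fun x : ℝ => (x : ℂ)) = Algebra.embeddingsMatrixReindex ℚ ℂ b e *
      Matrix.diagonal (fun j => ((Real.exp (2 * u (InfinitePlace.mk (e j).toRingHom)) : ℝ) : ℂ)) *
      (Algebra.embeddingsMatrixReindex ℚ ℂ b e)ᴴ := by
  ext i j
  rw [Matrix.map_apply, gram_cast, Matrix.mul_apply]
  refine (Fintype.sum_equiv e _ _ fun l => ?_).symm
  rw [Matrix.mul_diagonal, Matrix.conjTranspose_apply]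
  simp [Algebra.embeddingsMatrixReindex]
  ring

lemma gram_det (u : InfinitePlace K → ℝ) (b : Module.Basis ι ℚ K) :
    (gram u b).det = Real.exp (2 * ell u) * |(Algebra.discr ℚ b : ℝ)| := by
  obtain ⟨e⟩ := exists_emb_equiv b
  have h1 : (((gram u b).det : ℝ) : ℂ) = ((gram u b).map (fun x : ℝ => (x : ℂ))).det := by
    exact RingHom.map_det Complex.ofRealHom (gram u b)
  rw [gram_map u b e, Matrix.det_mul, Matrix.det_mul, Matrix.det_diagonal, Matrix.det_conjTranspose] at h1
  have h2 := Algebra.discr_eq_det_embeddingsMatrixReindex_pow_two ℚ ℂ b e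
  set D := (Algebra.embeddingsMatrixReindex ℚ ℂ b e).det
  have h3 : |(Algebra.discr ℚ b : ℝ)| = ‖D‖^2 := by
    rw [← norm_pow, ← h2]
    simp
  have h4 : ∏ j, ((Real.exp (2 * u (InfinitePlace.mk (e j).toRingHom)) : ℝ) : ℂ) = ((Real.exp (2 * ell u) : ℝ) : ℂ) := by
    rw [← Complex.ofReal_prod, ← Real.exp_sum, ← Finset.mul_sum, ell, ← sum_emb u]
    congr 4
    exact Fintype.sum_equiv e _ _ fun l => rfl
  rw [h4] at h1
  have h5 : ((gram u b).det : ℂ) = ((Real.exp (2 * ell u) * ‖D‖^2 : ℝ) : ℂ) := by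
    rw [h1]
    push_cast
    rw [← Complex.mul_conj']
    simp only [RCLike.star_def]
    ring
  rw [h3]
  exact_mod_cast h5

lemma gram_posDef (u : InfinitePlace K → ℝ) (b : Module.Basis ι ℚ K) : (gram u b).PosDef := by
  obtain ⟨e⟩ := exists_emb_equiv b
  refine Matrix.PosDef.of_dotProduct_mulVec_pos ?_ ?_
  · ext i j
    rw [Matrix.conjTranspose_apply, star_trivial]
    simp only [gram]
    refine Finset.sum_congr rfl fun σ _ => ?_
    congr 1
    simp [Complex.mul_re]; ring
  · intro x hx
    rw [star_trivial, gram_quad]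
    refine lt_of_le_of_ne (Finset.sum_nonneg fun σ _ => by positivity) fun h => hx ?_
    have h0 := (Finset.sum_eq_zero_iff_of_nonneg (fun σ _ => by positivity)).mp h.symm
    have h1 : Matrix.vecMul (fun i => (x i : ℂ)) (Algebra.embeddingsMatrixReindex ℚ ℂ b e) = 0 := by
      ext j
      have := h0 (e j) (Finset.mem_univ _)
      have h3 := (mul_eq_zero.mp this).resolve_left (Real.exp_pos _).ne'
      have h4 := norm_eq_zero.mp (pow_eq_zero_iff two_ne_zero |>.mp h3)
      simpa [Matrix.vecMul, dotProduct, Algebra.embeddingsMatrixReindex] using h4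
    have h2 : (Algebra.embeddingsMatrixReindex ℚ ℂ b e).det ≠ 0 := by
      have := Algebra.discr_eq_det_embeddingsMatrixReindex_pow_two ℚ ℂ b e
      intro h
      rw [h] at this
      have h5 := Algebra.discr_not_zero_of_basis ℚ b
      simp at this
      exact h5 this
    have h3 := Matrix.eq_zero_of_vecMul_eq_zero h2 h1
    ext i
    have := congrFun h3 i
    simpa using this

lemma gram_inv (u : InfinitePlace K → ℝ) (b : Module.Basis ι ℚ K) :
    (gram u b)⁻¹ = gram (-u) b.traceDual := by
  obtain ⟨e⟩ := exists_emb_equiv b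
  refine Matrix.inv_eq_right_inv ?_
  set B := Algebra.embeddingsMatrixReindex ℚ ℂ b e with hB
  set B' := Algebra.embeddingsMatrixReindex ℚ ℂ b.traceDual e with hB'
  have h1 : B * B'ᵀ = 1 := by
    ext i j
    rw [Matrix.mul_apply]
    have h := Module.Basis.trace_mul_traceDual b i j
    have h' := congrArg (algebraMap ℚ ℂ) h
    rw [trace_eq_sum_embeddings ℂ] at h'
    have : (∑ l, B i l * B'ᵀ l j) = ∑ σ : K →ₐ[ℚ] ℂ, σ (b i * b.traceDual j) := by
      refine Fintype.sum_equiv e _ _ fun l => ?_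
      simp [hB, hB', Algebra.embeddingsMatrixReindex]
    rw [this]
    rw [mul_comm] at h'
    rw [Matrix.one_apply]
    first
    | simpa [eq_comm] using h'
    | (rw [mul_comm] at h'; simpa [eq_comm] using h')
  have h2 : Bᴴ * (B'ᵀ)ᴴ = 1 := by
    rw [← Matrix.conjTranspose_mul, mul_eq_one_comm.mp h1, Matrix.conjTranspose_one]
  have h3 : (gram u b).map (fun x : ℝ => (x : ℂ)) * (gram (-u) b.traceDual).map (fun x : ℝ => (x : ℂ)) = 1 := by
    have h4 : (gram (-u) b.traceDual).map (fun x : ℝ => (x : ℂ)) = ((gram (-u) b.traceDual).map (fun x : ℝ => (x : ℂ)))ᴴᵀ := by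
      ext i j; simp
    rw [h4, gram_map _ _ e, gram_map _ _ e, ← hB, ← hB']
    simp only [Matrix.conjTranspose_mul, Matrix.conjTranspose_conjTranspose, Matrix.diagonal_conjTranspose, Matrix.transpose_mul, Matrix.diagonal_transpose]
    have h5 : (B'ᴴ)ᵀ = (B'ᵀ)ᴴ := rfl
    rw [h5]
    calc _ = B * Matrix.diagonal _ * (Bᴴ * (B'ᵀ)ᴴ) * Matrix.diagonal _ * B'ᵀ := by simp only [Matrix.mul_assoc]; rfl
      _ = B * (Matrix.diagonal _ * Matrix.diagonal _) * B'ᵀ := by rw [h2, Matrix.mul_one]; simp only [Matrix.mul_assoc]; rfl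
      _ = 1 := by
        rw [Matrix.diagonal_mul_diagonal]
        have : (fun i => ((Real.exp (2 * u (InfinitePlace.mk (e i).toRingHom)) : ℝ) : ℂ) *
            star (fun j => ((Real.exp (2 * (-u) (InfinitePlace.mk (e j).toRingHom)) : ℝ) : ℂ)) i) = fun _ => 1 := by
          ext i
          simp only [Pi.star_apply, RCLike.star_def, Complex.conj_ofReal, Pi.neg_apply]
          rw [← Complex.ofReal_mul, ← Real.exp_add]
          simp
        rw [this, Matrix.diagonal_one, Matrix.mul_one, h1]
  ext i j
  have h4 := congrFun (congrFun h3 i) j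
  have h5 : (((gram u b * gram (-u) b.traceDual) i j : ℝ) : ℂ) = (1 : Matrix ι ι ℂ) i j := by
    rw [← h4, Matrix.mul_apply, Matrix.mul_apply]
    push_cast
    rfl
  rw [Matrix.one_apply] at h5 ⊢
  split_ifs at h5 ⊢ <;> exact_mod_cast h5

theorem theta_basis (u : InfinitePlace K → ℝ) (b : Module.Basis ι ℚ K) :
    ∑' k : ι → ℤ, ENNReal.ofReal (Real.exp (-Real.pi * qf u (∑ i, k i • b i))) =
    ENNReal.ofReal ((Real.exp (ell u) * √|(Algebra.discr ℚ b : ℝ)|)⁻¹) *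
    ∑' k : ι → ℤ, ENNReal.ofReal (Real.exp (-Real.pi * qf (-u) (∑ i, k i • b.traceDual i))) := by
  have h := poisson_G (gram u b) (gram_posDef u b)
  have e1 : √(gram u b).det = Real.exp (ell u) * √|(Algebra.discr ℚ b : ℝ)| := by
    rw [gram_det, Real.sqrt_mul (Real.exp_pos _).le, mul_comm 2, Real.exp_mul]
    congr 1
    rw [show (2:ℝ) = ((2:ℕ):ℝ) by norm_num, Real.rpow_natCast, Real.sqrt_sq (Real.exp_pos _).le]
  rw [gram_inv, e1] at h
  simp_rw [gram_quad_int] at h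
  exact h

end DH
end PartP4b

section PartP4c
open MeasureTheory Set NumberField
open scoped ENNReal Matrix nonZeroDivisors
set_option linter.unusedSectionVars false
namespace DH

variable {K : Type*} [Field K] [NumberField K]

/-- theta sum -/
noncomputable def Theta (u : InfinitePlace K → ℝ) (I : FractionalIdeal (𝓞 K)⁰ K) : ℝ≥0∞ :=
  ∑' x : {x : K // x ∈ I}, ENNReal.ofReal (Real.exp (-Real.pi * qf u x.1))

/-- dual as a unit -/
noncomputable def dualU (I : (FractionalIdeal (𝓞 K)⁰ K)ˣ) : (FractionalIdeal (𝓞 K)⁰ K)ˣ :=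
  Units.mk0 (FractionalIdeal.dual ℤ ℚ I.1) (FractionalIdeal.dual_ne_zero ℤ ℚ I.ne_zero)

lemma sum_span {ι : Type*} [Fintype ι] (b : Module.Basis ι ℚ K) (I : FractionalIdeal (𝓞 K)⁰ K)
    (h : ∀ x, x ∈ I ↔ x ∈ Submodule.span ℤ (Set.range b)) (u : InfinitePlace K → ℝ) :
    Theta u I = ∑' k : ι → ℤ, ENNReal.ofReal (Real.exp (-Real.pi * qf u (∑ i, k i • b i))) := by
  let e1 : {x : K // x ∈ I} ≃ Submodule.span ℤ (Set.range b) := Equiv.subtypeEquivRight h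
  let e2 : Submodule.span ℤ (Set.range b) ≃ (ι → ℤ) := (b.restrictScalars ℤ).equivFun.toEquiv
  rw [Theta, ← (e1.trans e2).symm.tsum_eq]
  congr 1
  ext k
  congr 4
  have : ((e1.symm (e2.symm k)).1 : K) = ((e2.symm k : Submodule.span ℤ (Set.range b)) : K) := rfl
  rw [Equiv.symm_trans_apply, this]
  have h2 : e2.symm k = ∑ i, k i • (b.restrictScalars ℤ) i := by
    exact (b.restrictScalars ℤ).equivFun_symm_apply k
  rw [h2]
  simp

lemma discr_basis (I : (FractionalIdeal (𝓞 K)⁰ K)ˣ) [Fintype (Module.Free.ChooseBasisIndex ℤ I)] [DecidableEq (Module.Free.ChooseBasisIndex ℤ I)]: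
    |((Algebra.discr ℚ (basisOfFractionalIdeal K I) : ℚ) : ℝ)| = ((FractionalIdeal.absNorm I.1 : ℚ) : ℝ)^2 * |(discr K : ℝ)| := by
  classical
  let e : (Module.Free.ChooseBasisIndex ℤ (𝓞 K)) ≃ (Module.Free.ChooseBasisIndex ℤ I) := by
    refine Fintype.equivOfCardEq ?_
    rw [← Module.finrank_eq_card_basis (integralBasis K), Module.finrank_eq_card_basis (basisOfFractionalIdeal K I)]
  have h1 := det_basisOfFractionalIdeal_eq_absNorm K I e
  set b' := (basisOfFractionalIdeal K I).reindex e.symm with hb'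
  have h2 : Algebra.discr ℚ (basisOfFractionalIdeal K I) = Algebra.discr ℚ b' := by
    rw [hb', ← Algebra.discr_reindex ℚ _ e.symm]
    simp
  have h3 : Algebra.discr ℚ b' = ((integralBasis K).det b')^2 * (discr K : ℚ) := by
    rw [coe_discr, Module.Basis.det_apply]
    rw [← Algebra.discr_of_matrix_vecMul]
    congr 1
    ext j
    rw [Matrix.vecMul, dotProduct]
    have := (integralBasis K).sum_toMatrix_smul_self b' j
    rw [← this]
    refine Finset.sum_congr rfl fun i _ => ?_
    rw [Algebra.smul_def, mul_comm]
    rfl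
  rw [h2, h3]
  push_cast
  rw [abs_mul, abs_pow, ← h1]
  push_cast
  rfl

lemma absNorm_dualU (I : (FractionalIdeal (𝓞 K)⁰ K)ˣ) :
    FractionalIdeal.absNorm (dualU I).1 = (|discr K| * FractionalIdeal.absNorm I.1 : ℚ)⁻¹ := by
  have h1 : (dualU I).1 = FractionalIdeal.dual ℤ ℚ 1 * (I.1)⁻¹ := FractionalIdeal.dual_eq_mul_inv ℤ ℚ I.1
  have h2 := coeIdeal_differentIdeal ℤ ℚ K (𝓞 K)
  have h3 : FractionalIdeal.absNorm (FractionalIdeal.dual ℤ ℚ (1 : FractionalIdeal (𝓞 K)⁰ K)) = (|discr K| : ℚ)⁻¹ := by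
    have h4 := congrArg FractionalIdeal.absNorm h2
    rw [FractionalIdeal.coeIdeal_absNorm, NumberField.absNorm_differentIdeal (K := K), map_inv₀] at h4
    rw [← inv_inj, ← h4, inv_inv]
    simp
  rw [h1, map_mul, map_inv₀, h3, mul_inv]
  push_cast
  rfl

theorem theta_ideal (u : InfinitePlace K → ℝ) (I : (FractionalIdeal (𝓞 K)⁰ K)ˣ) :
    Theta u I.1 = ENNReal.ofReal ((Real.exp (ell u) * (√|(discr K : ℝ)| * ((FractionalIdeal.absNorm I.1 : ℚ) : ℝ)))⁻¹) *
      Theta (-u) (dualU I).1 := by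
  classical
  have hs1 : ∀ x, x ∈ I.1 ↔ x ∈ Submodule.span ℤ (Set.range (basisOfFractionalIdeal K I)) := by
    intro x
    rw [mem_span_basisOfFractionalIdeal]; rfl
  have hs2 : ∀ x, x ∈ (dualU I).1 ↔ x ∈ Submodule.span ℤ (Set.range (basisOfFractionalIdeal K I).traceDual) := by
    intro x
    rw [← Submodule.traceDual_span_of_basis ℤ (I.1 : Submodule (𝓞 K) K) (basisOfFractionalIdeal K I) (by
      ext y; exact hs1 y), ← FractionalIdeal.coe_dual ℤ ℚ I.ne_zero]
    rfl
  rw [sum_span _ _ hs1, sum_span _ _ hs2, theta_basis, discr_basis, Real.sqrt_mul (by positivity),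
    Real.sqrt_sq, mul_comm √|(discr K : ℝ)|]
  exact_mod_cast FractionalIdeal.absNorm_nonneg _

end DH
end PartP4c

section PartP5
open MeasureTheory Set NumberField
open scoped ENNReal Matrix nonZeroDivisors
set_option linter.unusedSectionVars false
namespace DH

variable {K : Type*} [Field K] [NumberField K]

instance countK : Countable K :=
  (Module.finBasis ℚ K).equivFun.toEquiv.injective.countable

instance countUnits : Countable (𝓞 K)ˣ :=
  Function.Injective.countable (f := fun ε : (𝓞 K)ˣ => ((ε : 𝓞 K) : K)) (fun a b h => by
    apply Units.ext; apply RingOfIntegers.ext; exact h)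

/-- logarithmic vector -/
noncomputable def Lg (x : K) : InfinitePlace K → ℝ := fun v => Real.log (v x)

lemma Lg_mul {x y : K} (hx : x ≠ 0) (hy : y ≠ 0) : Lg (x * y) = Lg x + Lg y := by
  ext v
  simp only [Lg, Pi.add_apply, map_mul]
  rw [Real.log_mul] <;> simpa

lemma qf_Lg (u : InfinitePlace K → ℝ) {x : K} (hx : x ≠ 0) (y : K) : qf (u + Lg x) y = qf u (x * y) := by
  simp only [qf, Lg, Pi.add_apply, map_mul]
  refine Finset.sum_congr rfl fun v _ => ?_
  have : 0 < v x := InfinitePlace.pos_iff.mpr hx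
  rw [mul_add, Real.exp_add, two_mul (Real.log _), Real.exp_add, Real.exp_log this]
  ring

lemma ell_add (u w : InfinitePlace K → ℝ) : ell (u + w) = ell u + ell w := by
  simp [ell, mul_add, Finset.sum_add_distrib]
lemma ell_neg (u : InfinitePlace K → ℝ) : ell (-u) = - ell u := by
  simp [ell]
lemma ell_const (c : ℝ) : ell (fun _ : InfinitePlace K => c) = Module.finrank ℚ K * c := by
  rw [ell, ← Finset.sum_mul, ← InfinitePlace.sum_mult_eq]
  push_cast
  rfl
lemma ell_Lg {x : K} (hx : x ≠ 0) : ell (Lg x) = Real.log |(Algebra.norm ℚ x : ℝ)| := by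
  have h := InfinitePlace.prod_eq_abs_norm x
  have h2 : |(Algebra.norm ℚ x : ℝ)| = ((|Algebra.norm ℚ x| : ℚ) : ℝ) := by push_cast; rfl
  rw [h2, ← h, Real.log_prod]
  · simp [ell, Lg]
  · intro v _
    have : v x ≠ 0 := by simpa
    positivity

lemma unit_ne (ε : (𝓞 K)ˣ) : ((ε : 𝓞 K) : K) ≠ 0 := by simp

lemma ell_Lg_unit (ε : (𝓞 K)ˣ) : ell (Lg ((ε : 𝓞 K) : K)) = 0 := by
  rw [ell_Lg (unit_ne ε)]
  have := (isUnit_iff_norm (x := (ε : 𝓞 K))).mp ε.isUnit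
  have h2 : |(Algebra.norm ℚ ((ε : 𝓞 K) : K) : ℝ)| = ((|Algebra.norm ℚ ((ε : 𝓞 K) : K)| : ℚ) : ℝ) := by push_cast; rfl
  rw [h2]
  rw [RingOfIntegers.coe_norm] at this
  rw [this]; simp

lemma Theta_lt_top (u : InfinitePlace K → ℝ) (I : (FractionalIdeal (𝓞 K)⁰ K)ˣ) : Theta u I.1 < ⊤ := by
  classical
  have hs1 : ∀ x, x ∈ I.1 ↔ x ∈ Submodule.span ℤ (Set.range (basisOfFractionalIdeal K I)) := by
    intro x
    rw [mem_span_basisOfFractionalIdeal]; rfl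
  rw [sum_span _ _ hs1]
  simp_rw [← gram_quad_int]
  obtain ⟨M, hM, hG⟩ := posDef_factor _ (gram_posDef u (basisOfFractionalIdeal K I))
  have hM' : IsUnit M.det := (Matrix.isUnit_iff_isUnit_det _).mp hM
  obtain ⟨c, hc, h⟩ := mulVec_lower M hM'
  rw [hG]
  have hs : Summable fun k : Module.Free.ChooseBasisIndex ℤ I → ℤ => Real.exp (-Real.pi * (toR k ⬝ᵥ (Mᵀ * M) *ᵥ toR k)) := by
    refine Summable.of_nonneg_of_le (fun k => (Real.exp_pos _).le) (fun k => ?_)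
      (summable_gauss_pi (ι := Module.Free.ChooseBasisIndex ℤ I) (Real.pi * c) (by positivity))
    apply Real.exp_le_exp.mpr
    have := h (toR k)
    have h1 : toR k ⬝ᵥ (Mᵀ * M) *ᵥ toR k = ∑ i, ((M *ᵥ toR k) i)^2 := by
      rw [← Matrix.mulVec_mulVec, Matrix.dotProduct_mulVec, Matrix.vecMul_transpose]
      simp [dotProduct, sq]
    rw [h1]
    simp only [toR] at this ⊢
    nlinarith [Real.pi_pos]
  exact hs.tsum_ofReal_lt_top

/-- trace zero projection -/
noncomputable def prj (u : InfinitePlace K → ℝ) : InfinitePlace K → ℝ :=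
  fun v => u v - ell u / Module.finrank ℚ K

/-- bump -/
noncomputable def psi (u : InfinitePlace K → ℝ) : ℝ≥0∞ := ENNReal.ofReal (Real.exp (-Real.pi * qf (prj u) 1))
/-- sum of bump over units -/
noncomputable def Psi (u : InfinitePlace K → ℝ) : ℝ≥0∞ := ∑' ε : (𝓞 K)ˣ, psi (u + Lg ((ε : 𝓞 K) : K))
/-- partition of unity -/
noncomputable def om (u : InfinitePlace K → ℝ) : ℝ≥0∞ := psi u / Psi u

lemma prj_const (u : InfinitePlace K → ℝ) (c : ℝ) : prj (u + fun _ => c) = prj u := by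
  ext v
  have : (Module.finrank ℚ K : ℝ) ≠ 0 := by exact_mod_cast Module.finrank_pos.ne'
  simp only [prj, ell_add, ell_const, Pi.add_apply]
  field_simp; ring

lemma prj_unit (u : InfinitePlace K → ℝ) (ε : (𝓞 K)ˣ) : prj (u + Lg ((ε : 𝓞 K) : K)) = prj u + Lg ((ε : 𝓞 K) : K) := by
  ext v
  simp only [prj, ell_add, ell_Lg_unit, Pi.add_apply]
  ring

lemma Psi_lt_top (u : InfinitePlace K → ℝ) : Psi u < ⊤ := by
  refine lt_of_le_of_lt ?_ (Theta_lt_top (prj u) 1)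
  let g : (𝓞 K)ˣ → {x : K // x ∈ (1 : (FractionalIdeal (𝓞 K)⁰ K)ˣ).1} := fun ε => ⟨((ε : 𝓞 K) : K), by
    rw [Units.val_one, FractionalIdeal.mem_one_iff]; exact ⟨_, rfl⟩⟩
  have hg : Function.Injective g := fun a b h => by
    apply Units.ext; apply RingOfIntegers.ext; exact congrArg (fun z : {x : K // x ∈ (1 : (FractionalIdeal (𝓞 K)⁰ K)ˣ).1} => z.1) h
  rw [Theta]
  refine le_trans (le_of_eq ?_) (ENNReal.tsum_comp_le_tsum_of_injective hg _)
  rw [Psi]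
  congr 1
  ext ε
  rw [psi, prj_unit, qf_Lg _ (unit_ne ε), mul_one]

lemma psi_pos (u : InfinitePlace K → ℝ) : 0 < psi u := by
  rw [psi, ENNReal.ofReal_pos]; exact Real.exp_pos _

lemma Psi_ne_zero (u : InfinitePlace K → ℝ) : Psi u ≠ 0 := by
  intro h
  rw [Psi, ENNReal.tsum_eq_zero] at h
  exact (psi_pos _).ne' (h 1)

lemma Psi_unit (u : InfinitePlace K → ℝ) (ε : (𝓞 K)ˣ) : Psi (u + Lg ((ε : 𝓞 K) : K)) = Psi u := by
  rw [Psi]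
  conv_rhs => rw [Psi, ← (Equiv.mulLeft ε).tsum_eq]
  congr 1
  ext δ
  congr 1
  rw [add_assoc, ← Lg_mul (unit_ne _) (unit_ne _)]
  simp

lemma om_sum (u : InfinitePlace K → ℝ) : ∑' ε : (𝓞 K)ˣ, om (u + Lg ((ε : 𝓞 K) : K)) = 1 := by
  simp_rw [om, Psi_unit, div_eq_mul_inv]
  rw [ENNReal.tsum_mul_right]
  exact ENNReal.mul_inv_cancel (Psi_ne_zero u) (Psi_lt_top u).ne

lemma om_const (u : InfinitePlace K → ℝ) (c : ℝ) : om (u + fun _ => c) = om u := by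
  simp only [om, Psi, psi]
  congr 1
  · rw [prj_const]
  · congr 1
    ext ε
    rw [add_right_comm, prj_const]

lemma continuous_ell : Continuous (ell (K := K)) := by
  unfold ell; fun_prop
lemma continuous_qf (x : K) : Continuous (fun u => qf u x) := by
  unfold qf; fun_prop
lemma continuous_prj : Continuous (prj (K := K)) := by
  have := continuous_ell (K := K)
  unfold prj; fun_prop
lemma measurable_psi : Measurable (psi (K := K)) := by
  have h := (continuous_qf (1 : K)).comp continuous_prj
  unfold psi
  refine ENNReal.measurable_ofReal.comp ?_
  refine (Real.continuous_exp.comp ?_).measurable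
  exact continuous_const.mul h
lemma measurable_om : Measurable (om (K := K)) := by
  unfold om Psi
  refine measurable_psi.div ?_
  exact Measurable.tsum fun ε => measurable_psi.comp (measurable_add_const _)

end DH
end PartP5

section PartP6
open MeasureTheory Set NumberField
open scoped ENNReal Matrix nonZeroDivisors
set_option linter.unusedSectionVars false
namespace DH

variable {K : Type*} [Field K] [NumberField K]

variable (K) in
/-- class group -/
abbrev Cl := (FractionalIdeal (𝓞 K)⁰ K)ˣ ⧸ (toPrincipalIdeal (𝓞 K) K).range

noncomputable instance finCl : Fintype (Cl K) :=
  Fintype.ofEquiv (ClassGroup (𝓞 K)) (ClassGroup.equiv K).toEquiv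

variable (K) in
/-- nonzero ideals -/
abbrev NzI := {I : Ideal (𝓞 K) // I ≠ ⊥}

instance countNzI : Countable (NzI K) := by
  have : Countable (Ideal (𝓞 K)) := by
    have hc : Countable (𝓞 K) := Function.Injective.countable (f := fun x : 𝓞 K => (x : K)) RingOfIntegers.coe_injective
    have hs : Function.Surjective (fun s : Finset (𝓞 K) => Ideal.span (s : Set (𝓞 K))) := by
      intro I
      obtain ⟨s, hs⟩ := (IsNoetherian.noetherian I : I.FG)
      exact ⟨s, hs⟩
    exact hs.countable
  infer_instance

/-- base gaussian -/
noncomputable def f0 (u : InfinitePlace K → ℝ) : ℝ≥0∞ := ENNReal.ofReal (Real.exp (-Real.pi * qf u 1))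

/-- half log of discriminant -/
noncomputable def hd (K : Type*) [Field K] [NumberField K] : ℝ := Real.log |(discr K : ℝ)| / 2

variable (K) in
/-- the functional -/
noncomputable def Phi (F : ℝ → ℝ≥0∞) : ℝ≥0∞ :=
  ∑' I : NzI K, ∫⁻ u : InfinitePlace K → ℝ, f0 u * F (ell u + hd K - Real.log (Ideal.absNorm I.1))

lemma measurable_f0 : Measurable (f0 (K := K)) := by
  unfold f0
  refine ENNReal.measurable_ofReal.comp (Real.continuous_exp.comp ?_).measurable
  exact continuous_const.mul (continuous_qf 1)

lemma gexp_measurable (ξ : K) : Measurable fun u => ENNReal.ofReal (Real.exp (-Real.pi * qf u ξ)) := by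
  refine ENNReal.measurable_ofReal.comp (Real.continuous_exp.comp ?_).measurable
  exact continuous_const.mul (continuous_qf ξ)

lemma exists_ideal (a : (FractionalIdeal (𝓞 K)⁰ K)ˣ) (ξ : K) (h : ξ ∈ a.1) (h0 : ξ ≠ 0) :
    ∃ I : NzI K, FractionalIdeal.spanSingleton (𝓞 K)⁰ ξ = (I.1 : FractionalIdeal (𝓞 K)⁰ K) * a.1 := by
  have h1 : FractionalIdeal.spanSingleton (𝓞 K)⁰ ξ * (a⁻¹).1 ≤ 1 := by
    have : (1 : FractionalIdeal (𝓞 K)⁰ K) = a.1 * (a⁻¹).1 := by simp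
    rw [this]
    gcongr
    rwa [FractionalIdeal.spanSingleton_le_iff_mem]
  obtain ⟨I, hI⟩ := FractionalIdeal.le_one_iff_exists_coeIdeal.mp h1
  have h2 : FractionalIdeal.spanSingleton (𝓞 K)⁰ ξ = (I : FractionalIdeal (𝓞 K)⁰ K) * a.1 := by
    rw [hI, mul_assoc]; simp
  refine ⟨⟨I, ?_⟩, h2⟩
  rintro rfl
  simp at h2
  exact h0 (FractionalIdeal.spanSingleton_eq_zero_iff.mp h2)

/-- index set of pairs (class, element) -/
abbrev Sx (a : Cl K → (FractionalIdeal (𝓞 K)⁰ K)ˣ) := Σ C : Cl K, {ξ : K // ξ ∈ (a C).1 ∧ ξ ≠ 0}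

/-- ideal attached to a pair -/
noncomputable def toI (a : Cl K → (FractionalIdeal (𝓞 K)⁰ K)ˣ) (s : Sx a) : NzI K :=
  (exists_ideal (a s.1) s.2.1 s.2.2.1 s.2.2.2).choose
lemma toI_spec (a : Cl K → (FractionalIdeal (𝓞 K)⁰ K)ˣ) (s : Sx a) :
    FractionalIdeal.spanSingleton (𝓞 K)⁰ s.2.1 = ((toI a s).1 : FractionalIdeal (𝓞 K)⁰ K) * (a s.1).1 :=
  (exists_ideal (a s.1) s.2.1 s.2.2.1 s.2.2.2).choose_spec

lemma coe_injI {I J : NzI K} (h : (I.1 : FractionalIdeal (𝓞 K)⁰ K) = J.1) : I = J :=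
  Subtype.ext (FractionalIdeal.coeIdeal_injective h)

lemma mem_princ {a : (FractionalIdeal (𝓞 K)⁰ K)ˣ} : (QuotientGroup.mk a : Cl K) = 1 ↔
    ∃ x : K, FractionalIdeal.spanSingleton (𝓞 K)⁰ x = a.1 := by
  rw [QuotientGroup.eq_one_iff, mem_principal_ideals_iff]

lemma toI_norm (a : Cl K → (FractionalIdeal (𝓞 K)⁰ K)ˣ) (s : Sx a) :
    ell (Lg s.2.1) - Real.log ((FractionalIdeal.absNorm (a s.1).1 : ℚ) : ℝ) = Real.log (Ideal.absNorm (toI a s).1) := by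
  have h := congrArg FractionalIdeal.absNorm (toI_spec a s)
  rw [map_mul, FractionalIdeal.coeIdeal_absNorm, FractionalIdeal.absNorm_span_singleton] at h
  have h2 : |(Algebra.norm ℚ s.2.1 : ℝ)| = ((|Algebra.norm ℚ s.2.1| : ℚ) : ℝ) := by push_cast; rfl
  rw [ell_Lg s.2.2.2, h2, h]
  push_cast
  rw [Real.log_mul]
  · ring
  · have := (toI a s).2
    rw [Ne, Nat.cast_eq_zero, Ideal.absNorm_eq_zero_iff]
    exact this
  · have : FractionalIdeal.absNorm (a s.1).1 ≠ 0 := by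
      rw [Ne, FractionalIdeal.absNorm_eq_zero_iff]; exact (a s.1).ne_zero
    exact_mod_cast this

lemma fiber_equiv (a : Cl K → (FractionalIdeal (𝓞 K)⁰ K)ˣ)
    (ha : Function.Bijective fun C => (QuotientGroup.mk (a C) : Cl K)) (I : NzI K) :
    ∃ ξ₀ : K, ξ₀ ≠ 0 ∧ ∃ e : (𝓞 K)ˣ ≃ {s : Sx a // toI a s = I}, ∀ ε, (e ε).1.2.1 = ((ε : 𝓞 K) : K) * ξ₀ := by
  let Iu : (FractionalIdeal (𝓞 K)⁰ K)ˣ := Units.mk0 (I.1 : FractionalIdeal (𝓞 K)⁰ K) (by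
    simpa using I.2)
  obtain ⟨C, hC⟩ := ha.2 (QuotientGroup.mk Iu)⁻¹
  have h1 : (QuotientGroup.mk (Iu * a C) : Cl K) = 1 := by
    rw [QuotientGroup.mk_mul]
    simp only at hC
    rw [hC, mul_inv_cancel]
  obtain ⟨ξ, hξ⟩ := mem_princ.mp h1
  have hξ' : FractionalIdeal.spanSingleton (𝓞 K)⁰ ξ = (I.1 : FractionalIdeal (𝓞 K)⁰ K) * (a C).1 := hξ
  have hξ0 : ξ ≠ 0 := by
    rintro rfl
    rw [FractionalIdeal.spanSingleton_zero] at hξ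
    exact (Iu * a C).ne_zero hξ.symm
  have hu : ∀ ε : (𝓞 K)ˣ, FractionalIdeal.spanSingleton (𝓞 K)⁰ (((ε : 𝓞 K) : K) * ξ) = FractionalIdeal.spanSingleton (𝓞 K)⁰ ξ := by
    intro ε
    symm
    rw [FractionalIdeal.spanSingleton_eq_spanSingleton]
    exact ⟨ε, by rw [Units.smul_def, Algebra.smul_def]⟩
  have hmem : ∀ ε : (𝓞 K)ˣ, ((ε : 𝓞 K) : K) * ξ ∈ (a C).1 ∧ ((ε : 𝓞 K) : K) * ξ ≠ 0 := by
    intro ε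
    refine ⟨?_, mul_ne_zero (unit_ne _) hξ0⟩
    rw [← FractionalIdeal.spanSingleton_le_iff_mem, hu, hξ']
    calc _ ≤ 1 * (a C).1 := by gcongr; exact FractionalIdeal.coeIdeal_le_one
      _ = _ := one_mul _
  let g : (𝓞 K)ˣ → {s : Sx a // toI a s = I} := fun ε => ⟨⟨C, ⟨_, hmem ε⟩⟩, by
    apply coe_injI
    have := toI_spec a ⟨C, ⟨_, hmem ε⟩⟩
    simp only [hu, hξ'] at this
    exact (mul_right_cancel₀ (a C).ne_zero this).symm⟩
  have hg : Function.Bijective g := by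
    constructor
    · intro ε δ h
      have h2 := congrArg (fun z : {s : Sx a // toI a s = I} => z.1.2.1) h
      simp only [g] at h2
      apply Units.ext; apply RingOfIntegers.ext; exact mul_right_cancel₀ hξ0 h2
    · rintro ⟨⟨C', ⟨ξ', hm, h0⟩⟩, hs⟩
      have h3 := toI_spec a ⟨C', ⟨ξ', hm, h0⟩⟩
      rw [hs] at h3
      simp only at h3
      have h4 : C' = C := by
        apply ha.1
        have : (QuotientGroup.mk (Iu * a C') : Cl K) = 1 := mem_princ.mpr ⟨ξ', h3⟩
        rw [QuotientGroup.mk_mul] at this h1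
        exact mul_left_cancel (this.trans h1.symm)
      subst h4
      rw [← hξ'] at h3
      obtain ⟨ε, hε⟩ := FractionalIdeal.spanSingleton_eq_spanSingleton.mp h3.symm
      refine ⟨ε, ?_⟩
      apply Subtype.ext
      simp only [g]
      congr 1
      apply Subtype.ext
      simp only
      rw [← hε, Units.smul_def, Algebra.smul_def]
  exact ⟨ξ, hξ0, Equiv.ofBijective g hg, fun ε => rfl⟩

theorem unfold_eq (a : Cl K → (FractionalIdeal (𝓞 K)⁰ K)ˣ)
    (ha : Function.Bijective fun C => (QuotientGroup.mk (a C) : Cl K))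
    (w : (InfinitePlace K → ℝ) → ℝ≥0∞) (hw : Measurable w)
    (hw1 : ∀ u, ∑' ε : (𝓞 K)ˣ, w (u - Lg ((ε : 𝓞 K) : K)) = 1)
    (F : ℝ → ℝ≥0∞) (hF : Measurable F) :
    ∑' C : Cl K, ∫⁻ u, w u * (∑' ξ : {ξ : K // ξ ∈ (a C).1 ∧ ξ ≠ 0}, ENNReal.ofReal (Real.exp (-Real.pi * qf u ξ.1))) *
      F (ell u + hd K + Real.log ((FractionalIdeal.absNorm (a C).1 : ℚ) : ℝ)) = Phi K F := by
  have hFm : ∀ c, Measurable fun u : InfinitePlace K → ℝ => F (ell u + c) := fun c =>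
    hF.comp ((continuous_ell.add continuous_const).measurable)
  have step1 : ∀ C : Cl K, ∫⁻ u, w u * (∑' ξ : {ξ : K // ξ ∈ (a C).1 ∧ ξ ≠ 0}, ENNReal.ofReal (Real.exp (-Real.pi * qf u ξ.1))) *
      F (ell u + hd K + Real.log ((FractionalIdeal.absNorm (a C).1 : ℚ) : ℝ)) =
      ∑' ξ : {ξ : K // ξ ∈ (a C).1 ∧ ξ ≠ 0}, ∫⁻ u, w (u - Lg ξ.1) * (f0 u * F (ell u + hd K - Real.log (Ideal.absNorm (toI a ⟨C, ξ⟩).1))) := by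
    intro C
    simp_rw [← ENNReal.tsum_mul_left, ← ENNReal.tsum_mul_right]
    rw [lintegral_tsum]
    · refine tsum_congr fun ξ => ?_
      rw [← lintegral_sub_right_eq_self _ (Lg ξ.1)]
      refine lintegral_congr fun u => ?_
      rw [mul_assoc]
      congr 1
      have e1 : qf (u - Lg ξ.1) ξ.1 = qf u 1 := by
        conv_rhs => rw [show u = (u - Lg ξ.1) + Lg ξ.1 by simp, qf_Lg _ ξ.2.2, mul_one]
      rw [e1, f0]
      congr 2
      rw [← toI_norm, sub_eq_add_neg u, ell_add, ell_neg]
      ring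
    · intro ξ
      refine Measurable.aemeasurable ?_
      refine (hw.mul (gexp_measurable _)).mul ?_
      simp_rw [add_assoc]
      exact hFm _
  rw [tsum_congr step1, ← ENNReal.tsum_sigma' (fun s : Sx a => ∫⁻ u, w (u - Lg s.2.1) * (f0 u * F (ell u + hd K - Real.log (Ideal.absNorm (toI a s).1)))),
    ← (Equiv.sigmaFiberEquiv (toI a)).tsum_eq, ENNReal.tsum_sigma', Phi]
  refine tsum_congr fun I => ?_
  obtain ⟨ξ₀, hξ₀, e, he⟩ := fiber_equiv a ha I
  rw [← e.tsum_eq]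
  have h3 : ∀ ε : (𝓞 K)ˣ, ∫⁻ u, w (u - Lg ((Equiv.sigmaFiberEquiv (toI a)) ⟨I, e ε⟩).2.1) * (f0 u * F (ell u + hd K - Real.log (Ideal.absNorm (toI a ((Equiv.sigmaFiberEquiv (toI a)) ⟨I, e ε⟩)).1)))
     = ∫⁻ u, w (u - Lg ξ₀ - Lg ((ε : 𝓞 K) : K)) * (f0 u * F (ell u + hd K - Real.log (Ideal.absNorm I.1))) := by
    intro ε
    have h4 : (Equiv.sigmaFiberEquiv (toI a)) ⟨I, e ε⟩ = (e ε).1 := rfl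
    rw [h4, (e ε).2, he, Lg_mul (unit_ne _) hξ₀]
    refine lintegral_congr fun u => ?_
    congr 2
    abel
  rw [tsum_congr h3, ← lintegral_tsum]
  · refine lintegral_congr fun u => ?_
    rw [ENNReal.tsum_mul_right, hw1, one_mul]
  · intro ε
    refine Measurable.aemeasurable ?_
    refine Measurable.mul ?_ (measurable_f0.mul ?_)
    · exact hw.comp ((measurable_id.sub_const _).sub_const _)
    · simp_rw [add_sub_assoc]; exact hFm _

end DH
end PartP6

section PartP8
open MeasureTheory Set NumberField UniqueFactorizationMonoid
open scoped ENNReal Matrix nonZeroDivisors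
set_option linter.unusedSectionVars false
namespace DH

variable {K : Type*} [Field K] [NumberField K]

lemma card_over_le (p : ℕ) (hp : p.Prime) (s : Finset (Ideal (𝓞 K)))
    (hs : ∀ P ∈ s, P.IsMaximal ∧ (p : 𝓞 K) ∈ P ∧ p ∣ Ideal.absNorm P) : s.card ≤ Module.finrank ℚ K := by
  have h1 : ∏ P ∈ s, P ∣ Ideal.span {(p : 𝓞 K)} := by
    refine Finset.prod_dvd_of_coprime (s := fun P : Ideal (𝓞 K) => P) ?_ ?_
    · intro P hP Q hQ hne
      have := (hs P hP).1
      have := (hs Q hQ).1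
      change IsCoprime P Q
      exact Ideal.isCoprime_of_isMaximal hne
    · intro P hP
      rw [Ideal.dvd_span_singleton]
      exact (hs P hP).2.1
  have h2 := map_dvd Ideal.absNorm h1
  have h3 : Ideal.absNorm (Ideal.span {(p : 𝓞 K)}) = p ^ Module.finrank ℚ K := by
    rw [Ideal.absNorm_span_singleton]
    have : Algebra.norm ℤ (p : 𝓞 K) = (p : ℤ) ^ Module.finrank ℤ (𝓞 K) := by
      simpa using Algebra.norm_algebraMap (R := ℤ) (S := 𝓞 K) (p : ℤ)
    rw [this, RingOfIntegers.rank, Int.natAbs_pow, Int.natAbs_natCast]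
  rw [h3, map_prod] at h2
  have h4 : p ^ s.card ∣ ∏ P ∈ s, Ideal.absNorm P := by
    rw [← Finset.prod_const]
    exact Finset.prod_dvd_prod_of_dvd _ _ fun P hP => (hs P hP).2.2
  exact (Nat.pow_dvd_pow_iff_le_right hp.one_lt).mp (h4.trans h2)

lemma prod_fiber {α : Type*} {n : ℕ} (j : α → Fin n) (p : α → ℕ) (s : Multiset α) :
    ∏ i, ((s.filter (fun a => j a = i)).map p).prod = (s.map p).prod := by
  induction s using Multiset.induction_on with
  | empty => simp
  | cons a s ih =>
    have : ∀ i, (((a ::ₘ s).filter (fun a => j a = i)).map p).prod = (if j a = i then p a else 1) * ((s.filter (fun a => j a = i)).map p).prod := by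
      intro i
      by_cases h : j a = i
      · simp [h]
      · simp [h]
    simp_rw [this]
    rw [Finset.prod_mul_distrib, ih]
    simp

theorem exists_tuple : ∃ m : NzI K → Fin (Module.finrank ℚ K) → ℕ, Function.Injective m ∧
    ∀ I, (∀ i, 0 < m I i) ∧ ∏ i, m I i ≤ Ideal.absNorm I.1 := by
  classical
  set n := Module.finrank ℚ K with hn
  have hn0 : 0 < n := Module.finrank_pos
  have h1 : ∀ P : Ideal (𝓞 K), ∃ p : ℕ, P.IsMaximal → ((p : 𝓞 K) ∈ P ∧ p.Prime ∧ p ∣ Ideal.absNorm P) := by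
    intro P
    by_cases hP : P.IsMaximal
    · obtain ⟨p, k, hk, h1, h2, h3⟩ := Ideal.exists_prime_and_absNorm_eq_pow P
      exact ⟨p, fun _ => ⟨h1, h2, h3 ▸ dvd_pow_self p hk.ne'⟩⟩
    · exact ⟨0, fun h => absurd h hP⟩
  choose p hp using h1
  have h2 : ∀ q : ℕ, ∃ j : Ideal (𝓞 K) → Fin n, Set.InjOn j {P | P.IsMaximal ∧ p P = q} := by
    intro q
    by_cases hne : ∃ P : Ideal (𝓞 K), P.IsMaximal ∧ p P = q
    · obtain ⟨P0, hP0, hq0⟩ := hne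
      have hq : q.Prime := hq0 ▸ (hp P0 hP0).2.1
      have hfin : {P : Ideal (𝓞 K) | P.IsMaximal ∧ p P = q}.Finite := by
        by_contra hinf
        obtain ⟨s, hs, hc⟩ := (Set.not_finite.mp hinf : Set.Infinite _).exists_subset_card_eq (n+1)
        have := card_over_le q hq s (fun P hP => by
          have := hs hP
          exact ⟨this.1, this.2 ▸ (hp P this.1).1, this.2 ▸ (hp P this.1).2.2⟩)
        omega
      have hc : hfin.toFinset.card ≤ n := card_over_le q hq _ (fun P hP => by
          have := hfin.mem_toFinset.mp hP
          exact ⟨this.1, this.2 ▸ (hp P this.1).1, this.2 ▸ (hp P this.1).2.2⟩)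
      obtain ⟨f⟩ : Nonempty (hfin.toFinset ↪ Fin n) := Function.Embedding.nonempty_of_card_le (by simpa using hc)
      refine ⟨fun P => if h : P ∈ hfin.toFinset then f ⟨P, h⟩ else ⟨0, hn0⟩, ?_⟩
      intro P hP Q hQ h
      have hP' := hfin.mem_toFinset.mpr hP
      have hQ' := hfin.mem_toFinset.mpr hQ
      simp only [hP', hQ', dif_pos] at h
      simpa using f.injective h
    · refine ⟨fun _ => ⟨0, hn0⟩, ?_⟩
      intro P hP
      exact absurd ⟨P, hP⟩ hne
  choose jj hjj using h2
  let j : Ideal (𝓞 K) → Fin n := fun P => jj (p P) P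
  have hmax : ∀ I : NzI K, ∀ P ∈ normalizedFactors I.1, P.IsMaximal := by
    intro I P hP
    have h := prime_of_normalized_factor P hP
    exact (Ideal.isPrime_of_prime h).isMaximal h.ne_zero
  let S : NzI K → Fin n → Multiset (Ideal (𝓞 K)) := fun I i => (normalizedFactors I.1).filter (fun P => j P = i)
  refine ⟨fun I i => ((S I i).map p).prod, ?_, ?_⟩
  · intro I J h
    have hS : ∀ i, S I i = S J i := by
      intro i
      have h3 := congrFun h i
      simp only at h3
      have hpr : ∀ I : NzI K, normalizedFactors ((S I i).map p).prod = (S I i).map p := by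
        intro I
        have := normalizedFactors_prod_of_prime (m := (S I i).map p) (by
          intro q hq
          obtain ⟨P, hP, rfl⟩ := Multiset.mem_map.mp hq
          exact ((hp P (hmax I P (Multiset.mem_filter.mp hP).1)).2.1).prime)
        exact this
      have h4 : (S I i).map p = (S J i).map p := by rw [← hpr I, h3, hpr J]
      let g : ℕ → Ideal (𝓞 K) := Function.invFunOn p {P | P.IsMaximal ∧ j P = i}
      have hinj : Set.InjOn p {P : Ideal (𝓞 K) | P.IsMaximal ∧ j P = i} := by
        intro P hP Q hQ h
        refine hjj (p P) ⟨hP.1, rfl⟩ ⟨hQ.1, h.symm⟩ ?_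
        have e1 : jj (p P) P = i := hP.2
        have e2 : jj (p Q) Q = i := hQ.2
        rw [h] at e1 ⊢
        rw [e1, e2]
      have hg : ∀ I : NzI K, ((S I i).map p).map g = S I i := by
        intro I
        rw [Multiset.map_map]
        conv_rhs => rw [← Multiset.map_id (S I i)]
        refine Multiset.map_congr rfl fun P hP => ?_
        obtain ⟨h5, h6⟩ := Multiset.mem_filter.mp hP
        exact hinj.leftInvOn_invFunOn ⟨hmax I P h5, h6⟩
      rw [← hg I, h4, hg J]
    have hnf : normalizedFactors I.1 = normalizedFactors J.1 := by
      ext P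
      have := congrArg (Multiset.count P) (hS (j P))
      simpa [S, Multiset.count_filter] using this
    apply Subtype.ext
    have hI : (normalizedFactors I.1).prod = I.1 := associated_iff_eq.mp (prod_normalizedFactors (by simpa using I.2))
    have hJ : (normalizedFactors J.1).prod = J.1 := associated_iff_eq.mp (prod_normalizedFactors (by simpa using J.2))
    rw [← hI, hnf, hJ]
  · intro I
    have hpos : ∀ P ∈ normalizedFactors I.1, 0 < p P := fun P hP => (hp P (hmax I P hP)).2.1.pos
    refine ⟨fun i => ?_, ?_⟩
    · simp only
      refine Nat.pos_of_ne_zero (Multiset.prod_ne_zero ?_)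
      intro h0
      obtain ⟨P, hP, h⟩ := Multiset.mem_map.mp h0
      exact (hpos P (Multiset.mem_filter.mp hP).1).ne' h
    · simp only [S]
      rw [prod_fiber j p]
      have hI : (normalizedFactors I.1).prod = I.1 := associated_iff_eq.mp (prod_normalizedFactors (by simpa using I.2))
      have : Ideal.absNorm I.1 = ((normalizedFactors I.1).map Ideal.absNorm).prod := by
        conv_lhs => rw [← hI]
        exact map_multiset_prod _ _
      rw [this]
      refine Multiset.prod_map_le_prod_map₀ _ _ (fun P hP => Nat.zero_le _) fun P hP => ?_
      have hm := hmax I P hP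
      refine Nat.le_of_dvd (Nat.pos_of_ne_zero ?_) (hp P hm).2.2
      rw [Ne, Ideal.absNorm_eq_zero_iff]
      exact (prime_of_normalized_factor P hP).ne_zero

variable (K) in
/-- zeta sum -/
noncomputable def Zs (s : ℝ) : ℝ≥0∞ := ∑' I : NzI K, ENNReal.ofReal ((Ideal.absNorm I.1 : ℝ) ^ (-s))

lemma norm_pos (I : NzI K) : (0:ℝ) < Ideal.absNorm I.1 := by
  have : Ideal.absNorm I.1 ≠ 0 := by rw [Ne, Ideal.absNorm_eq_zero_iff]; exact I.2
  positivity

theorem Zs_le (s : ℝ) (hs : 1 < s) : Zs K s ≤ ENNReal.ofReal (∑' m : ℕ, (m : ℝ) ^ (-s)) ^ (Module.finrank ℚ K) := by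
  obtain ⟨m, hm, hm2⟩ := exists_tuple (K := K)
  have hsum : Summable fun m : ℕ => (m : ℝ) ^ (-s) := Real.summable_nat_rpow.mpr (by linarith)
  rw [ENNReal.ofReal_tsum_of_nonneg (fun _ => by positivity) hsum, ← tsum_pi_fin]
  refine le_trans ?_ (ENNReal.tsum_comp_le_tsum_of_injective hm _)
  refine ENNReal.tsum_le_tsum fun I => ?_
  rw [← ENNReal.ofReal_prod_of_nonneg (fun _ _ => by positivity)]
  refine ENNReal.ofReal_le_ofReal ?_
  rw [Real.finsetProd_rpow _ _ (fun _ _ => by positivity)]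
  refine Real.rpow_le_rpow_of_nonpos ?_ ?_ (by linarith)
  · exact Finset.prod_pos fun i _ => by exact_mod_cast (hm2 I).1 i
  · exact_mod_cast (hm2 I).2

end DH
end PartP8

section PartP9a
open MeasureTheory Set NumberField
open scoped ENNReal Matrix nonZeroDivisors
set_option linter.unusedSectionVars false
namespace DH

variable {K : Type*} [Field K] [NumberField K]

variable (K) in
/-- gamma factor -/
noncomputable def gam (s : ℝ) : ℝ≥0∞ := ∫⁻ u : InfinitePlace K → ℝ, f0 u * ENNReal.ofReal (Real.exp (s * ell u))

lemma integrable_exp_neg_abs' (a : ℝ) (ha : 0 < a) : Integrable (fun t : ℝ => Real.exp (-(a * |t|))) := by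
  rw [← integrableOn_univ, ← Iic_union_Ioi (a := (0:ℝ))]
  refine IntegrableOn.union ?_ ?_
  · refine (integrableOn_exp_mul_Iic ha 0).congr_fun ?_ measurableSet_Iic
    intro t ht
    simp [abs_of_nonpos (show t ≤ 0 from ht)]
  · refine (exp_neg_integrableOn_Ioi 0 ha).congr_fun ?_ measurableSet_Ioi
    intro t ht
    simp [abs_of_pos (show 0 < t from ht)]

lemma expo_le (m s t : ℝ) (hm : m = 1 ∨ m = 2) (hs : 0 < s) :
    -Real.pi * (m * Real.exp (2 * t)) + s * (m * t) ≤ 2 * s ^ 2 - s * |t| := by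
  have h0 : s * t - Real.pi * Real.exp (2 * t) ≤ s ^ 2 - s * |t| := by
    have hp := Real.pi_gt_three
    have he := Real.exp_pos (2 * t)
    rcases le_total t 0 with h | h
    · rw [abs_of_nonpos h]; nlinarith [mul_pos Real.pi_pos he, sq_nonneg s]
    · rw [abs_of_nonneg h]
      have := Real.quadratic_le_exp_of_nonneg (x := 2 * t) (by linarith)
      have h3 : Real.pi * (2 * t ^ 2) ≤ Real.pi * Real.exp (2 * t) := by
        apply mul_le_mul_of_nonneg_left _ (by linarith)
        nlinarith
      nlinarith [sq_nonneg (s - t), sq_nonneg t]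
  have := abs_nonneg t
  rcases hm with rfl | rfl
  · nlinarith [sq_nonneg s]
  · nlinarith [mul_nonneg hs.le this]

lemma mult_cases (v : InfinitePlace K) : (v.mult : ℝ) = 1 ∨ (v.mult : ℝ) = 2 := by
  unfold InfinitePlace.mult; split_ifs <;> simp

lemma f0_mul (u : InfinitePlace K → ℝ) (s : ℝ) : f0 u * ENNReal.ofReal (Real.exp (s * ell u)) =
    ENNReal.ofReal (Real.exp (∑ v, (-Real.pi * (v.mult * Real.exp (2 * u v)) + s * (v.mult * u v)))) := by
  rw [f0, ← ENNReal.ofReal_mul (Real.exp_pos _).le, ← Real.exp_add, Finset.sum_add_distrib, ← Finset.mul_sum, ← Finset.mul_sum]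
  simp [qf, ell]

lemma card_places_le : Fintype.card (InfinitePlace K) ≤ Module.finrank ℚ K := by
  rw [← InfinitePlace.sum_mult_eq]
  rw [← Finset.card_univ, Finset.card_eq_sum_ones]
  refine Finset.sum_le_sum fun v _ => ?_
  unfold InfinitePlace.mult; split_ifs <;> simp

lemma gam_le (s : ℝ) (hs : 0 < s) : ∃ C : ℝ, 1 ≤ C ∧ ∀ (K : Type) [Field K] [NumberField K],
    gam K s ≤ ENNReal.ofReal (C ^ Module.finrank ℚ K) := by
  set g : ℝ → ℝ := fun t => Real.exp (2 * s ^ 2 - s * |t|) with hg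
  have hgi : Integrable g := by
    have := (integrable_exp_neg_abs' s hs).const_mul (Real.exp (2 * s ^ 2))
    refine this.congr (Filter.Eventually.of_forall fun t => ?_)
    simp only [hg]
    rw [← Real.exp_add]; congr 1
  refine ⟨max 1 (∫ t, g t), le_max_left _ _, ?_⟩
  intro K _ _
  have hi : Integrable (fun u : InfinitePlace K → ℝ => ∏ v, g (u v)) := by
    exact Integrable.fintype_prod (f := fun _ => g) fun _ => hgi
  have h1 : gam K s ≤ ∫⁻ u : InfinitePlace K → ℝ, ENNReal.ofReal (∏ v, g (u v)) := by
    refine lintegral_mono fun u => ?_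
    dsimp only
    rw [f0_mul]
    apply ENNReal.ofReal_le_ofReal
    rw [Real.exp_sum]
    refine Finset.prod_le_prod (fun _ _ => (Real.exp_pos _).le) fun v _ => ?_
    exact Real.exp_le_exp.mpr (expo_le _ _ _ (mult_cases v) hs)
  refine h1.trans ?_
  rw [← ofReal_integral_eq_lintegral_ofReal hi (Filter.Eventually.of_forall fun u =>
    Finset.prod_nonneg fun _ _ => (Real.exp_pos _).le)]
  apply ENNReal.ofReal_le_ofReal
  rw [integral_fintype_prod_volume_eq_prod (fun _ : InfinitePlace K => g), Finset.prod_const, Finset.card_univ]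
  have h0 : 0 ≤ ∫ t, g t := integral_nonneg fun t => (Real.exp_pos _).le
  calc _ ≤ (max 1 (∫ t, g t)) ^ Fintype.card (InfinitePlace K) := pow_le_pow_left₀ h0 (le_max_right _ _) _
    _ ≤ _ := pow_le_pow_right₀ (le_max_left _ _) card_places_le

lemma hd_exp (s : ℝ) : Real.exp (s * hd K) = |(discr K : ℝ)| ^ (s / 2) := by
  have : 0 < |(discr K : ℝ)| := by
    have := discr_ne_zero K
    positivity
  rw [Real.rpow_def_of_pos this, hd]; congr 1; ring

lemma Phi_exp (s : ℝ) : Phi K (fun z => ENNReal.ofReal (Real.exp (s * z))) =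
    gam K s * ENNReal.ofReal (Real.exp (s * hd K)) * Zs K s := by
  rw [Phi, Zs, ← ENNReal.tsum_mul_left]
  congr 1
  ext I
  have : ∀ u : InfinitePlace K → ℝ, f0 u * ENNReal.ofReal (Real.exp (s * (ell u + hd K - Real.log (Ideal.absNorm I.1)))) =
      (f0 u * ENNReal.ofReal (Real.exp (s * ell u))) * (ENNReal.ofReal (Real.exp (s * hd K)) * ENNReal.ofReal ((Ideal.absNorm I.1 : ℝ) ^ (-s))) := by
    intro u
    rw [mul_assoc, ← ENNReal.ofReal_mul (Real.exp_pos _).le, ← ENNReal.ofReal_mul (Real.exp_pos _).le,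
      Real.rpow_def_of_pos (norm_pos I), ← Real.exp_add, ← Real.exp_add]
    congr 3; ring
  simp_rw [this]
  rw [lintegral_mul_const' _ _ (by finiteness), ← gam, mul_assoc]

/-- for s greater than 1 -/
lemma Phi_exp_le (s : ℝ) (hs : 1 < s) : ∃ C : ℝ, 1 ≤ C ∧ ∀ (K : Type) [Field K] [NumberField K],
    Phi K (fun z => ENNReal.ofReal (Real.exp (s * z))) ≤ ENNReal.ofReal (C ^ Module.finrank ℚ K * Real.exp (s * hd K)) := by
  obtain ⟨C, hC, h⟩ := gam_le s (by linarith)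
  set D := max 1 (∑' m : ℕ, (m : ℝ) ^ (-s))
  have hD : 1 ≤ D := le_max_left _ _
  refine ⟨C * D, by nlinarith, ?_⟩
  intro K _ _
  have h2 : Zs K s ≤ ENNReal.ofReal (D ^ Module.finrank ℚ K) := by
    refine (Zs_le s hs).trans ?_
    rw [ENNReal.ofReal_pow (by linarith)]
    gcongr
    exact le_max_right _ _
  rw [Phi_exp]
  calc _ ≤ ENNReal.ofReal (C ^ Module.finrank ℚ K) * ENNReal.ofReal (Real.exp (s * hd K)) * ENNReal.ofReal (D ^ Module.finrank ℚ K) := by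
        gcongr; exact h K
    _ = _ := by
        rw [← ENNReal.ofReal_mul (by positivity), ← ENNReal.ofReal_mul (by positivity)]
        congr 1; rw [mul_pow]; ring

lemma gam_lt_top {K : Type} [Field K] [NumberField K] (s : ℝ) (hs : 0 < s) : gam K s < ⊤ := by
  obtain ⟨C, hC, h⟩ := gam_le s hs
  exact (h K).trans_lt ENNReal.ofReal_lt_top
lemma Phi_exp_lt_top {K : Type} [Field K] [NumberField K] (s : ℝ) (hs : 1 < s) : Phi K (fun z => ENNReal.ofReal (Real.exp (s * z))) < ⊤ := by
  obtain ⟨C, hC, h⟩ := Phi_exp_le s hs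
  exact (h K).trans_lt ENNReal.ofReal_lt_top
end DH
end PartP9a

section PartP7
open MeasureTheory Set NumberField
open scoped ENNReal Matrix nonZeroDivisors
set_option linter.unusedSectionVars false
namespace DH

variable {K : Type*} [Field K] [NumberField K]

/-- nonzero part of theta -/
noncomputable def nz (u : InfinitePlace K → ℝ) (I : (FractionalIdeal (𝓞 K)⁰ K)ˣ) : ℝ≥0∞ :=
  ∑' ξ : {ξ : K // ξ ∈ I.1 ∧ ξ ≠ 0}, ENNReal.ofReal (Real.exp (-Real.pi * qf u ξ.1))

/-- shifted level -/
noncomputable def zc (I : (FractionalIdeal (𝓞 K)⁰ K)ˣ) (u : InfinitePlace K → ℝ) : ℝ :=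
  ell u + hd K + Real.log ((FractionalIdeal.absNorm I.1 : ℚ) : ℝ)

lemma nz_measurable (I : (FractionalIdeal (𝓞 K)⁰ K)ˣ) : Measurable fun u => nz u I :=
  Measurable.tsum fun _ => gexp_measurable _

lemma Theta_nz (u : InfinitePlace K → ℝ) (I : (FractionalIdeal (𝓞 K)⁰ K)ˣ) : Theta u I.1 = 1 + nz u I := by
  classical
  let g : K → ℝ≥0∞ := fun x => ENNReal.ofReal (Real.exp (-Real.pi * qf u x))
  have h1 : Theta u I.1 = ∑' x : K, ({x | x ∈ I.1} : Set K).indicator g x := by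
    rw [Theta, ← tsum_subtype]; rfl
  have h2 : nz u I = ∑' x : K, ({x | x ∈ I.1 ∧ x ≠ 0} : Set K).indicator g x := by
    rw [nz, ← tsum_subtype]; rfl
  have h3 : (1 : ℝ≥0∞) = ∑' x : K, ({0} : Set K).indicator g x := by
    rw [← tsum_subtype, tsum_singleton (0 : K) g]
    simp [g, qf]
  rw [h1, h2]
  conv_rhs => rw [h3]
  rw [← ENNReal.tsum_add]
  congr 1
  ext x
  by_cases hx : x = 0
  · subst hx
    simp [Set.indicator, I.1.zero_mem]
  · simp [Set.indicator, hx]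

lemma absNorm_pos (I : (FractionalIdeal (𝓞 K)⁰ K)ˣ) : (0 : ℝ) < ((FractionalIdeal.absNorm I.1 : ℚ) : ℝ) := by
  have h : FractionalIdeal.absNorm I.1 ≠ 0 := by
    rw [Ne, FractionalIdeal.absNorm_eq_zero_iff]; exact I.ne_zero
  have h2 := FractionalIdeal.absNorm_nonneg I.1
  exact_mod_cast lt_of_le_of_ne h2 h.symm

lemma discr_pos : 0 < |(discr K : ℝ)| := by
  have := discr_ne_zero K
  positivity

lemma zc_dual (I : (FractionalIdeal (𝓞 K)⁰ K)ˣ) (u : InfinitePlace K → ℝ) : zc (dualU I) (-u) = - zc I u := by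
  have h1 := absNorm_pos I
  have h2 := discr_pos (K := K)
  rw [zc, zc, absNorm_dualU, ell_neg]
  have : (((|discr K| : ℤ) * FractionalIdeal.absNorm I.1 : ℚ)⁻¹ : ℝ) = (|(discr K : ℝ)| * ((FractionalIdeal.absNorm I.1 : ℚ) : ℝ))⁻¹ := by
    push_cast; rfl
  push_cast at this ⊢
  rw [Real.log_inv, Real.log_mul h2.ne' h1.ne', hd]
  ring

lemma theta_nz (u : InfinitePlace K → ℝ) (I : (FractionalIdeal (𝓞 K)⁰ K)ˣ) :
    1 + nz u I = ENNReal.ofReal (Real.exp (-(zc I u))) * (1 + nz (-u) (dualU I)) := by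
  have h1 := absNorm_pos I
  have h2 := discr_pos (K := K)
  rw [← Theta_nz, ← Theta_nz, theta_ideal]
  congr 2
  rw [Real.exp_neg, zc, Real.exp_add, Real.exp_log h1, Real.exp_add, mul_assoc]
  congr 3
  rw [hd, Real.exp_half, Real.exp_log h2]

lemma Lg_inv_unit (ε : (𝓞 K)ˣ) : Lg (((ε⁻¹ : (𝓞 K)ˣ) : 𝓞 K) : K) = - Lg ((ε : 𝓞 K) : K) := by
  have h := Lg_mul (unit_ne ε) (unit_ne ε⁻¹)
  have h1 : ((ε : 𝓞 K) : K) * (((ε⁻¹ : (𝓞 K)ˣ) : 𝓞 K) : K) = 1 := by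
    rw [← map_mul]; simp
  rw [h1] at h
  have h0 : Lg (1 : K) = 0 := by ext v; simp [Lg]
  rw [h0] at h
  exact (neg_eq_of_add_eq_zero_right h.symm).symm

lemma om_sum1 (u : InfinitePlace K → ℝ) : ∑' ε : (𝓞 K)ˣ, om (u - Lg ((ε : 𝓞 K) : K)) = 1 := by
  rw [← om_sum u, ← (Equiv.inv (𝓞 K)ˣ).tsum_eq]
  congr 1; ext ε
  rw [Equiv.inv_apply, Lg_inv_unit, sub_neg_eq_add]

lemma om_sum2 (u : InfinitePlace K → ℝ) : ∑' ε : (𝓞 K)ˣ, om (-(u - Lg ((ε : 𝓞 K) : K))) = 1 := by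
  rw [← om_sum (-u)]
  congr 1; ext ε
  congr 1; abel

variable (K) in
/-- pushforward measure -/
noncomputable def nu : Measure ℝ := ((volume : Measure (InfinitePlace K → ℝ)).withDensity om).map ell

lemma lintegral_nu (F : ℝ → ℝ≥0∞) (hF : Measurable F) : ∫⁻ z, F z ∂(nu K) = ∫⁻ u : InfinitePlace K → ℝ, om u * F (ell u) := by
  rw [nu, lintegral_map hF continuous_ell.measurable]
  exact lintegral_withDensity_eq_lintegral_mul _ measurable_om (hF.comp continuous_ell.measurable)

lemma nu_shift (F : ℝ → ℝ≥0∞) (c : ℝ) :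
    ∫⁻ u : InfinitePlace K → ℝ, om u * F (ell u + c) = ∫⁻ u : InfinitePlace K → ℝ, om u * F (ell u) := by
  have hn : (Module.finrank ℚ K : ℝ) ≠ 0 := by exact_mod_cast Module.finrank_pos.ne'
  rw [← lintegral_add_right_eq_self (μ := volume) (fun u : InfinitePlace K → ℝ => om u * F (ell u)) (fun _ => c / Module.finrank ℚ K)]
  congr 1; ext u
  rw [om_const, ell_add, ell_const]
  congr 3; field_simp

instance nu_inv : (nu K).IsAddLeftInvariant := by
  constructor
  intro c
  refine Measure.ext_of_lintegral _ fun F hF => ?_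
  rw [lintegral_map hF (measurable_const_add c), lintegral_nu _ hF, lintegral_nu (fun a => F (c + a)) (hF.comp (measurable_const_add c))]
  rw [← nu_shift F c]
  simp_rw [add_comm c]

lemma single_le (a : Cl K → (FractionalIdeal (𝓞 K)⁰ K)ˣ)
    (ha : Function.Bijective fun C => (QuotientGroup.mk (a C) : Cl K)) (F : ℝ → ℝ≥0∞) (hF : Measurable F) (C : Cl K) :
    ∫⁻ u, om u * nz u (a C) * F (zc (a C) u) ≤ Phi K F := by
  rw [← unfold_eq a ha om measurable_om om_sum1 F hF]
  exact ENNReal.le_tsum (f := fun C => ∫⁻ u, om u * nz u (a C) * F (zc (a C) u)) C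

lemma nz_ge (u : InfinitePlace K → ℝ) (I : (FractionalIdeal (𝓞 K)⁰ K)ˣ) (h : zc I u ≤ -1) : 1 ≤ nz u I := by
  have h1 := theta_nz u I
  have h2 : (2 : ℝ≥0∞) ≤ ENNReal.ofReal (Real.exp (-(zc I u))) := by
    rw [← ENNReal.ofReal_ofNat]
    apply ENNReal.ofReal_le_ofReal
    have := Real.add_one_le_exp (-(zc I u)); linarith
  have h3 : (2 : ℝ≥0∞) ≤ 1 + nz u I := by
    rw [h1]
    calc (2 : ℝ≥0∞) ≤ ENNReal.ofReal (Real.exp (-(zc I u))) * 1 := by rwa [mul_one]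
      _ ≤ _ := by gcongr; exact le_self_add
  rw [← one_add_one_eq_two] at h3
  exact (ENNReal.add_le_add_iff_left ENNReal.one_ne_top).mp h3

lemma out_bij : Function.Bijective fun C : Cl K => (QuotientGroup.mk (Quotient.out C) : Cl K) := by
  have : (fun C : Cl K => (QuotientGroup.mk (Quotient.out C) : Cl K)) = id := by
    ext C; exact QuotientGroup.out_eq' C
  rw [this]; exact Function.bijective_id

lemma dual_bij : Function.Bijective fun C : Cl K => (QuotientGroup.mk (dualU (Quotient.out C)) : Cl K) := by
  have h : ∀ C : Cl K, (QuotientGroup.mk (dualU (Quotient.out C)) : Cl K) = QuotientGroup.mk (dualU 1) * C⁻¹ := by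
    intro C
    conv_rhs => rw [← QuotientGroup.out_eq' C]
    rw [← QuotientGroup.mk_inv, ← QuotientGroup.mk_mul]
    congr 1
    ext1
    rw [Units.val_mul, Units.val_inv_eq_inv_val]
    exact FractionalIdeal.dual_eq_mul_inv ℤ ℚ _
  have h2 : (fun C : Cl K => (QuotientGroup.mk (dualU (Quotient.out C)) : Cl K)) =
      ((Equiv.inv (Cl K)).trans (Equiv.mulLeft (QuotientGroup.mk (dualU 1)))) := by
    ext C; rw [h]; rfl
  rw [h2]; exact Equiv.bijective _

section
variable {K : Type} [Field K] [NumberField K]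

instance nu_fin : IsFiniteMeasureOnCompacts (nu K) := by
  let C : Cl K := 1
  set I := (Quotient.out C : (FractionalIdeal (𝓞 K)⁰ K)ˣ) with hI
  set c := hd K + Real.log ((FractionalIdeal.absNorm I.1 : ℚ) : ℝ) with hc
  have hz : ∀ u, zc I u = ell u + c := fun u => by rw [zc, hc, add_assoc]
  have key : nu K (Ioo (-2) (-1)) ≠ ⊤ := by
    set F : ℝ → ℝ≥0∞ := (Ioo (-2 : ℝ) (-1)).indicator 1 with hF
    have hFm : Measurable F := measurable_one.indicator measurableSet_Ioo
    have h1 : nu K (Ioo (-2) (-1)) = ∫⁻ z, F z ∂(nu K) := by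
      rw [hF, lintegral_indicator_one measurableSet_Ioo]
    rw [h1, lintegral_nu F hFm, ← nu_shift F c]
    have h2 : ∫⁻ u : InfinitePlace K → ℝ, om u * F (ell u + c) ≤ Phi K F := by
      refine le_trans (lintegral_mono fun u => ?_) (single_le _ out_bij F hFm C)
      dsimp only
      rw [← hI, hz]
      by_cases h : ell u + c ∈ Ioo (-2 : ℝ) (-1)
      · have := nz_ge u I (by rw [hz]; exact h.2.le)
        calc om u * F (ell u + c) = om u * 1 * F (ell u + c) := by rw [mul_one]
          _ ≤ _ := by gcongr
      · simp [hF, h]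
    have h3 : Phi K F ≤ Phi K (fun z => ENNReal.ofReal (Real.exp (2 * z))) * ENNReal.ofReal (Real.exp 4) := by
      rw [Phi, Phi, ← ENNReal.tsum_mul_right]
      refine ENNReal.tsum_le_tsum fun J => ?_
      rw [← lintegral_mul_const' _ _ (by finiteness)]
      refine lintegral_mono fun u => ?_
      dsimp only
      rw [mul_assoc]
      gcongr
      by_cases h : ell u + hd K - Real.log (Ideal.absNorm J.1) ∈ Ioo (-2 : ℝ) (-1)
      · rw [hF, Set.indicator_of_mem h, ← ENNReal.ofReal_mul (Real.exp_pos _).le, ← Real.exp_add, Pi.one_apply,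
          ← ENNReal.ofReal_one]
        apply ENNReal.ofReal_le_ofReal
        apply Real.one_le_exp
        linarith [h.1]
      · rw [hF, Set.indicator_of_notMem h]; exact zero_le
    exact (h2.trans h3).trans_lt (ENNReal.mul_lt_top (Phi_exp_lt_top 2 (by norm_num)) ENNReal.ofReal_lt_top) |>.ne
  constructor
  intro S hS
  exact measure_lt_top_of_isCompact_of_isAddLeftInvariant (Ioo (-2 : ℝ) (-1)) isOpen_Ioo ⟨-1.5, by norm_num, by norm_num⟩ key hS

variable (K) in
lemma exists_kappa : ∃ κ : NNReal, ∀ F : ℝ → ℝ≥0∞, Measurable F → ∀ c,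
    ∫⁻ u : InfinitePlace K → ℝ, om u * F (ell u + c) = κ * ∫⁻ z, F z := by
  refine ⟨Measure.addHaarScalarFactor (nu K) volume, fun F hF c => ?_⟩
  have h := Measure.isAddLeftInvariant_eq_smul (nu K) (volume : Measure ℝ)
  rw [nu_shift, ← lintegral_nu F hF]
  calc _ = ∫⁻ z, F z ∂((Measure.addHaarScalarFactor (nu K) volume) • (volume : Measure ℝ)) := by rw [← h]
    _ = _ := by rw [lintegral_smul_measure]; simp [ENNReal.smul_def]

variable (K) in
theorem hecke : ∃ A : ℝ, 0 ≤ A ∧ ∀ F : ℝ → ℝ≥0∞, Measurable F →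
    Phi K F + ENNReal.ofReal A * ∫⁻ z, F z =
    Phi K (fun z => F (-z) * ENNReal.ofReal (Real.exp z)) +
      ENNReal.ofReal A * ∫⁻ z, F z * ENNReal.ofReal (Real.exp (-z)) := by
  obtain ⟨κ, hκ⟩ := exists_kappa K
  refine ⟨Fintype.card (Cl K) * κ, by positivity, fun F hF => ?_⟩
  have hA : ENNReal.ofReal (Fintype.card (Cl K) * κ) = Fintype.card (Cl K) * (κ : ℝ≥0∞) := by
    rw [ENNReal.ofReal_mul (by positivity)]; simp
  rw [hA]
  have hsum : ∀ G : ℝ → ℝ≥0∞, Measurable G → (Fintype.card (Cl K) * (κ : ℝ≥0∞)) * ∫⁻ z, G z =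
      ∑' C : Cl K, ∫⁻ u, om u * G (zc (Quotient.out C) u) := by
    intro G hG
    have : ∀ C : Cl K, ∫⁻ u, om u * G (zc (Quotient.out C) u) = κ * ∫⁻ z, G z := by
      intro C
      rw [← hκ G hG (hd K + Real.log ((FractionalIdeal.absNorm (Quotient.out C : (FractionalIdeal (𝓞 K)⁰ K)ˣ).1 : ℚ) : ℝ))]
      simp_rw [zc, add_assoc]
    simp_rw [this]
    rw [tsum_fintype]; simp [mul_assoc]
  have hem : Measurable fun z : ℝ => ENNReal.ofReal (Real.exp z) := ENNReal.measurable_ofReal.comp Real.measurable_exp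
  have hG1 : Measurable fun z : ℝ => F z * ENNReal.ofReal (Real.exp (-z)) := hF.mul (hem.comp measurable_neg)
  have hG2 : Measurable fun z : ℝ => F (-z) * ENNReal.ofReal (Real.exp z) := (hF.comp measurable_neg).mul hem
  have hzm : ∀ I : (FractionalIdeal (𝓞 K)⁰ K)ˣ, Measurable (zc I) := fun I =>
    ((continuous_ell.add continuous_const).add continuous_const).measurable
  rw [hsum F hF, hsum _ hG1, ← unfold_eq _ out_bij om measurable_om om_sum1 F hF,
    ← unfold_eq _ dual_bij (fun u => om (-u)) (measurable_om.comp measurable_neg) om_sum2 _ hG2,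
    ← ENNReal.tsum_add, ← ENNReal.tsum_add]
  congr 1
  ext C
  set I := (Quotient.out C : (FractionalIdeal (𝓞 K)⁰ K)ˣ) with hI
  change (∫⁻ u, om u * nz u I * F (zc I u)) + _ = (∫⁻ u, om (-u) * nz u (dualU I) *
    (F (-(zc (dualU I) u)) * ENNReal.ofReal (Real.exp (zc (dualU I) u)))) + _
  rw [← lintegral_neg_eq_self (μ := volume) (fun u => om (-u) * nz u (dualU I) *
    (F (-(zc (dualU I) u)) * ENNReal.ofReal (Real.exp (zc (dualU I) u))))]
  rw [← lintegral_add_right, ← lintegral_add_right]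
  · congr 1
    ext u
    have := theta_nz u I
    rw [zc_dual, neg_neg, neg_neg]
    calc _ = om u * F (zc I u) * (1 + nz u I) := by ring
      _ = _ := by rw [this]; ring
  · exact measurable_om.mul (hG1.comp (hzm I))
  · exact measurable_om.mul (hF.comp (hzm I))
end
end DH
end PartP7

section PartP9
open MeasureTheory Set NumberField ProbabilityTheory
open scoped ENNReal Matrix nonZeroDivisors Topology
set_option linter.unusedSectionVars false
namespace DH

variable {K : Type} [Field K] [NumberField K]

variable (K) in
/-- measure representing the functional -/
noncomputable def mu : Measure ℝ := Measure.sum fun I : NzI K =>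
  ((volume : Measure (InfinitePlace K → ℝ)).withDensity f0).map (fun u => ell u + hd K - Real.log (Ideal.absNorm I.1))

lemma lintegral_mu (F : ℝ → ℝ≥0∞) (hF : Measurable F) : ∫⁻ z, F z ∂(mu K) = Phi K F := by
  rw [mu, lintegral_sum_measure, Phi]
  congr 1; ext I
  have hm : Measurable fun u : InfinitePlace K → ℝ => ell u + hd K - Real.log (Ideal.absNorm I.1) :=
    ((continuous_ell.add continuous_const).sub continuous_const).measurable
  rw [lintegral_map hF hm]
  exact lintegral_withDensity_eq_lintegral_mul _ measurable_f0 (hF.comp hm)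

lemma mexp (s : ℝ) : Measurable fun z : ℝ => ENNReal.ofReal (Real.exp (s * z)) := by fun_prop

lemma integrable_of_lint {Ω : Type*} [MeasurableSpace Ω] (m : Measure Ω) (X : Ω → ℝ) (hX : Measurable X) (s : ℝ)
    (h : ∫⁻ z, ENNReal.ofReal (Real.exp (s * X z)) ∂m < ⊤) : Integrable (fun z => Real.exp (s * X z)) m := by
  have hm : Measurable fun z => Real.exp (s * X z) := by fun_prop
  refine ⟨hm.aestronglyMeasurable, ?_⟩
  rwa [hasFiniteIntegral_iff_ofReal (Filter.Eventually.of_forall fun z => (Real.exp_pos _).le)]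

lemma lint_of_integrable {Ω : Type*} [MeasurableSpace Ω] (m : Measure Ω) (X : Ω → ℝ) (s : ℝ)
    (h : Integrable (fun z => Real.exp (s * X z)) m) :
    ∫⁻ z, ENNReal.ofReal (Real.exp (s * X z)) ∂m = ENNReal.ofReal (mgf X m s) := by
  rw [mgf, ofReal_integral_eq_lintegral_ofReal h (Filter.Eventually.of_forall fun z => (Real.exp_pos _).le)]

lemma integrable_mu (s : ℝ) (hs : 1 < s) : Integrable (fun z => Real.exp (s * z)) (mu K) := by
  apply integrable_of_lint (mu K) (fun z => z) measurable_id
  rw [lintegral_mu _ (mexp s)]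
  exact Phi_exp_lt_top s hs

lemma integrable_mu_Ici (s : ℝ) : Integrable (fun z => Real.exp (s * z)) ((mu K).restrict (Ici 0)) := by
  have h := (integrable_mu (K := K) (max s 2) (lt_of_lt_of_le one_lt_two (le_max_right _ _))).restrict (s := Ici 0)
  have hm : Measurable fun z : ℝ => Real.exp (s * z) := by fun_prop
  refine h.mono' hm.aestronglyMeasurable ?_
  rw [ae_restrict_iff' measurableSet_Ici]
  refine Filter.Eventually.of_forall fun z hz => ?_
  rw [Real.norm_of_nonneg (Real.exp_pos _).le]
  apply Real.exp_le_exp.mpr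
  exact mul_le_mul_of_nonneg_right (le_max_left _ _) hz

lemma integrable_mu_Ioi (s : ℝ) : Integrable (fun z => Real.exp (s * z)) ((mu K).restrict (Ioi 0)) :=
  (integrable_mu_Ici (K := K) s).mono_measure (Measure.restrict_mono Ioi_subset_Ici_self le_rfl)

lemma punctured_preconn : IsPreconnected {s : ℂ | 0 < s.re ∧ s ≠ 1} := by
  have c1 : IsPreconnected {s : ℂ | 0 < s.re ∧ s.re < 1} :=
    ((convex_halfSpace_re_gt 0).inter (convex_halfSpace_re_lt 1)).isPreconnected
  have c2 : IsPreconnected {s : ℂ | 0 < s.re ∧ 0 < s.im} :=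
    ((convex_halfSpace_re_gt 0).inter (convex_halfSpace_im_gt 0)).isPreconnected
  have c3 : IsPreconnected {s : ℂ | 0 < s.re ∧ s.im < 0} :=
    ((convex_halfSpace_re_gt 0).inter (convex_halfSpace_im_lt 0)).isPreconnected
  have c4 : IsPreconnected {s : ℂ | 1 < s.re} := (convex_halfSpace_re_gt 1).isPreconnected
  have u1 := IsPreconnected.union (⟨1/2, 1⟩ : ℂ) (by simp; norm_num) (by simp) c1 c2
  have u2 := IsPreconnected.union (⟨1/2, -1⟩ : ℂ) (by simp; norm_num) (by simp) u1 c3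
  have u3 := IsPreconnected.union (⟨2, 1⟩ : ℂ) (by simp) (by simp) u2 c4
  convert u3 using 1
  ext s
  simp only [mem_ofPred_eq, mem_union, Ne, Complex.ext_iff, Complex.one_re, Complex.one_im]
  constructor
  · rintro ⟨h1, h2⟩
    rcases lt_trichotomy s.re 1 with h | h | h
    · exact Or.inl (Or.inl (Or.inl ⟨h1, h⟩))
    · rcases lt_trichotomy s.im 0 with h' | h' | h'
      · exact Or.inl (Or.inr ⟨h1, h'⟩)
      · exact absurd ⟨h, h'⟩ h2
      · exact Or.inl (Or.inl (Or.inr ⟨h1, h'⟩))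
    · exact Or.inr h
  · rintro (((⟨h1, h2⟩ | ⟨h1, h2⟩) | ⟨h1, h2⟩) | h)
    · exact ⟨h1, fun h => by linarith [h.1]⟩
    · exact ⟨h1, fun h => by linarith [h.2]⟩
    · exact ⟨h1, fun h => by linarith [h.2]⟩
    · exact ⟨by linarith, fun hh => by linarith [hh.1]⟩

/-- integrals of exponentials on half line -/
lemma lint_exp_Iio (a B : ℝ) (ha : 0 < a) : ∫⁻ z, (Iio B).indicator (fun z => ENNReal.ofReal (Real.exp (a * z))) z = ENNReal.ofReal (Real.exp (a * B) / a) := by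
  rw [lintegral_indicator measurableSet_Iio, Measure.restrict_congr_set Iio_ae_eq_Iic]
  rw [← ofReal_integral_eq_lintegral_ofReal (integrableOn_exp_mul_Iic ha B) (Filter.Eventually.of_forall fun z => (Real.exp_pos _).le),
    integral_exp_mul_Iic ha]

variable (K) in
/-- the residue constant -/
noncomputable def Ares : ℝ := (hecke K).choose
lemma Ares_nonneg : 0 ≤ Ares K := (hecke K).choose_spec.1

lemma hecke_mu (F : ℝ → ℝ≥0∞) (hF : Measurable F) :
    ∫⁻ z, F z ∂(mu K) + ENNReal.ofReal (Ares K) * ∫⁻ z, F z =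
    ∫⁻ z, F (-z) * ENNReal.ofReal (Real.exp z) ∂(mu K) +
      ENNReal.ofReal (Ares K) * ∫⁻ z, F z * ENNReal.ofReal (Real.exp (-z)) := by
  rw [lintegral_mu _ hF, lintegral_mu]
  · exact (hecke K).choose_spec.2 F hF
  · exact (hF.comp measurable_neg).mul (by fun_prop)

/-- Hecke identity for truncated exponentials -/
lemma hecke_exp (s B : ℝ) (hs : 1 < s) :
    ∫⁻ z in Iio B, ENNReal.ofReal (Real.exp (s * z)) ∂(mu K) + ENNReal.ofReal (Ares K * (Real.exp (s * B) / s)) =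
    ∫⁻ z in Ioi (-B), ENNReal.ofReal (Real.exp ((1 - s) * z)) ∂(mu K) +
      ENNReal.ofReal (Ares K * (Real.exp ((s - 1) * B) / (s - 1))) := by
  have h := hecke_mu (K := K) ((Iio B).indicator (fun z => ENNReal.ofReal (Real.exp (s * z)))) ((mexp s).indicator measurableSet_Iio)
  rw [lint_exp_Iio s B (by linarith), lintegral_indicator measurableSet_Iio, ← ENNReal.ofReal_mul Ares_nonneg] at h
  rw [h]
  congr 1
  · rw [← lintegral_indicator measurableSet_Ioi]
    congr 1; ext z
    by_cases hz : -B < z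
    · rw [indicator_of_mem (show -z ∈ Iio B by simp; linarith), indicator_of_mem (show z ∈ Ioi (-B) from hz),
        ← ENNReal.ofReal_mul (Real.exp_pos _).le, ← Real.exp_add]
      congr 2; ring
    · rw [indicator_of_notMem (show ¬ (-z ∈ Iio B) by simp; linarith), indicator_of_notMem (show ¬ (z ∈ Ioi (-B)) from hz), zero_mul]
  · rw [ENNReal.ofReal_mul Ares_nonneg, ← lint_exp_Iio (s - 1) B (by linarith)]
    congr 2; ext z
    by_cases hz : z ∈ Iio B
    · rw [indicator_of_mem hz, indicator_of_mem hz, ← ENNReal.ofReal_mul (Real.exp_pos _).le, ← Real.exp_add]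
      congr 2; ring
    · rw [indicator_of_notMem hz, indicator_of_notMem hz, zero_mul]

variable (K) in
/-- upper -/
noncomputable def Pf (s : ℝ) : ℝ := ∫ z in Ici 0, Real.exp (s * z) ∂(mu K)
variable (K) in
/-- lower -/
noncomputable def Qf (s : ℝ) : ℝ := ∫ z in Ioi 0, Real.exp (s * z) ∂(mu K)

lemma lam_real (s : ℝ) (hs : 1 < s) : mgf (fun z => z) (mu K) s = Ares K / (s - 1) - Ares K / s + Pf K s + Qf K (1 - s) := by
  have h := hecke_exp (K := K) s 0 hs
  have hi := integrable_mu (K := K) s hs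
  have h1 := lint_of_integrable _ (fun z => z) s (hi.restrict (s := Iio 0))
  have h2 := lint_of_integrable _ (fun z => z) (1 - s) (integrable_mu_Ioi (K := K) (1 - s))
  rw [neg_zero, h1, h2, ← ENNReal.ofReal_add, ← ENNReal.ofReal_add, ENNReal.ofReal_eq_ofReal_iff] at h
  · have h3 := integral_add_compl (s := Iio (0:ℝ)) measurableSet_Iio hi
    rw [compl_Iio] at h3
    simp only [mgf, mul_zero, Real.exp_zero] at h ⊢
    rw [← h3, Pf, Qf]
    have e1 : Ares K * (1 / s) = Ares K / s := by ring
    have e2 : Ares K * (1 / (s - 1)) = Ares K / (s - 1) := by ring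
    linarith
  all_goals first | apply add_nonneg | skip
  all_goals first | exact mgf_nonneg | skip
  all_goals exact mul_nonneg Ares_nonneg (div_nonneg (Real.exp_pos _).le (by linarith))

theorem zero_identity (ζ : ℂ → ℂ) (hζ : ∀ s : ℂ, s ≠ 1 → AnalyticAt ℂ ζ s)
    (hζ2 : ∀ s : ℂ, 1 < s.re →
            ζ s = ∑' I : {I : Ideal (𝓞 K) // I ≠ ⊥}, (Ideal.absNorm I.1 : ℂ) ^ (-s))
    (β : ℝ) (h0 : 0 < β) (h1 : β < 1) (hz : ζ β = 0) :
    Ares K / (β * (1 - β)) = Pf K β + Qf K (1 - β) := by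
  set m0 := (volume : Measure (InfinitePlace K → ℝ)).withDensity f0 with hm0
  have hγ : ∀ s : ℝ, ∫⁻ u, ENNReal.ofReal (Real.exp (s * ell u)) ∂m0 = gam K s := by
    intro s
    rw [hm0, gam]
    have hem : Measurable fun u : InfinitePlace K → ℝ => ENNReal.ofReal (Real.exp (s * ell u)) := by
      have := (continuous_ell (K := K)).measurable; fun_prop
    exact lintegral_withDensity_eq_lintegral_mul _ measurable_f0 hem
  have hγi : ∀ s : ℝ, 0 < s → Integrable (fun u => Real.exp (s * ell u)) m0 := fun s hs =>
    integrable_of_lint m0 ell continuous_ell.measurable s (by rw [hγ]; exact gam_lt_top s hs)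
  let f : ℂ → ℂ := fun s => complexMGF ell m0 s * Complex.exp (s * hd K) * ζ s
  let g : ℂ → ℂ := fun s => (Ares K : ℂ) / (s - 1) - Ares K / s + complexMGF (fun z => z) ((mu K).restrict (Ici 0)) s +
    complexMGF (fun z => z) ((mu K).restrict (Ioi 0)) (1 - s)
  have hreal : ∀ s : ℝ, 1 < s → f s = g s := by
    intro s hs
    have e1 : complexMGF ell m0 s = ((gam K s).toReal : ℂ) := by
      rw [complexMGF_ofReal, ← hγ s, lint_of_integrable m0 ell s (hγi s (by linarith)), ENNReal.toReal_ofReal mgf_nonneg]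
    have e2 : ζ s = ((Zs K s).toReal : ℂ) := by
      rw [hζ2 s (by simpa using hs), Zs, ENNReal.tsum_toReal_eq (fun _ => ENNReal.ofReal_ne_top), Complex.ofReal_tsum]
      congr 1; ext I
      rw [ENNReal.toReal_ofReal (Real.rpow_nonneg (norm_pos I).le _), Complex.ofReal_cpow (norm_pos I).le]
      simp
    have e3 := lam_real (K := K) s hs
    have e4 : mgf (fun z => z) (mu K) s = (gam K s).toReal * Real.exp (s * hd K) * (Zs K s).toReal := by
      have := lint_of_integrable (mu K) (fun z => z) s (integrable_mu s hs)
      rw [lintegral_mu _ (mexp s), Phi_exp] at this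
      have h5 := congrArg ENNReal.toReal this
      rw [ENNReal.toReal_ofReal mgf_nonneg, ENNReal.toReal_mul, ENNReal.toReal_mul, ENNReal.toReal_ofReal (Real.exp_pos _).le] at h5
      exact h5.symm
    simp only [f, g]
    rw [e1, e2, complexMGF_ofReal, show (1 - (s : ℂ)) = ((1 - s : ℝ) : ℂ) by push_cast; rfl, complexMGF_ofReal]
    rw [e4] at e3
    have e5 := congrArg (fun x : ℝ => (x : ℂ)) e3
    push_cast at e5
    exact e5
  have hS : ∀ s : Set ℝ, (∀ t : ℝ, Integrable (fun z => Real.exp (t * z)) ((mu K).restrict s)) → ∀ z, AnalyticAt ℂ (complexMGF (fun z => z) ((mu K).restrict s)) z := by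
    intro s h z
    apply analyticAt_complexMGF
    have : integrableExpSet (fun z : ℝ => z) ((mu K).restrict s) = univ := by
      ext t; simp only [mem_univ, iff_true]; exact h t
    rw [this]; simp
  have hfa : AnalyticOnNhd ℂ f {s : ℂ | 0 < s.re ∧ s ≠ 1} := by
    intro s hs
    have a1 : AnalyticAt ℂ (complexMGF ell m0) s := by
      apply analyticAt_complexMGF
      rw [mem_interior_iff_mem_nhds]
      filter_upwards [Ioi_mem_nhds hs.1] with t ht
      exact hγi t ht
    have a2 : AnalyticAt ℂ (fun s : ℂ => Complex.exp (s * hd K)) s := by fun_prop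
    exact (a1.mul a2).mul (hζ s hs.2)
  have hga : AnalyticOnNhd ℂ g {s : ℂ | 0 < s.re ∧ s ≠ 1} := by
    intro s hs
    have hs0 : s ≠ 0 := by rintro rfl; simp at hs
    have hs1 : s - 1 ≠ 0 := sub_ne_zero.mpr hs.2
    have a1 : AnalyticAt ℂ (fun s : ℂ => (Ares K : ℂ) / (s - 1)) s := analyticAt_const.div (analyticAt_id.sub analyticAt_const) hs1
    have a2 : AnalyticAt ℂ (fun s : ℂ => (Ares K : ℂ) / s) s := analyticAt_const.div analyticAt_id hs0
    have a3 := hS _ (integrable_mu_Ici (K := K)) s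
    have a4 : AnalyticAt ℂ (fun s : ℂ => complexMGF (fun z => z) ((mu K).restrict (Ioi 0)) (1 - s)) s :=
      AnalyticAt.fun_comp (hS _ (integrable_mu_Ioi (K := K)) (1 - s)) (analyticAt_const.sub analyticAt_id)
    exact ((a1.sub a2).add a3).add a4
  have hfreq : ∃ᶠ z in 𝓝[≠] (2 : ℂ), f z = g z := by
    have ht : Filter.Tendsto (fun x : ℝ => (x : ℂ)) (𝓝[≠] (2:ℝ)) (𝓝[≠] (2:ℂ)) := by
      refine tendsto_nhdsWithin_of_tendsto_nhds_of_eventually_within _ ?_ ?_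
      · exact (Complex.continuous_ofReal.tendsto' 2 2 (by simp)).mono_left nhdsWithin_le_nhds
      · filter_upwards [self_mem_nhdsWithin] with x hx
        simp only [mem_compl_iff, mem_singleton_iff] at hx ⊢
        exact_mod_cast hx
    refine ht.frequently (Filter.Eventually.frequently ?_)
    have : ∀ᶠ x : ℝ in 𝓝[≠] (2:ℝ), 1 < x := nhdsWithin_le_nhds (Ioi_mem_nhds one_lt_two)
    filter_upwards [this] with x hx using hreal x hx
  have heq := AnalyticOnNhd.eqOn_of_preconnected_of_frequently_eq hfa hga punctured_preconn (z₀ := 2) (by simp) hfreq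
  have hβ := heq (show (β : ℂ) ∈ {s : ℂ | 0 < s.re ∧ s ≠ 1} by
    refine ⟨by simpa using h0, ?_⟩
    exact_mod_cast h1.ne)
  simp only [f, g, hz, mul_zero] at hβ
  rw [complexMGF_ofReal, show (1 - (β : ℂ)) = ((1 - β : ℝ) : ℂ) by push_cast; rfl, complexMGF_ofReal] at hβ
  have hβ2 : (0 : ℝ) = Ares K / (β - 1) - Ares K / β + Pf K β + Qf K (1 - β) := by
    apply Complex.ofReal_injective
    rw [Pf, Qf]
    simp only [mgf] at hβ
    push_cast at hβ ⊢
    exact hβ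
  have : Ares K / (β * (1 - β)) = - (Ares K / (β - 1) - Ares K / β) := by
    have : 1 - β ≠ 0 := by linarith
    have : β - 1 ≠ 0 := by intro h; linarith
    field_simp; ring
  linarith
end DH
end PartP9

section PartP10
open MeasureTheory Set NumberField ProbabilityTheory
open scoped ENNReal Matrix nonZeroDivisors Topology
set_option linter.unusedSectionVars false
namespace DH

section
variable {K : Type} [Field K] [NumberField K]

variable (K) in
/-- log of discriminant -/
noncomputable def ld : ℝ := Real.log |(discr K : ℝ)|

lemma hd_eq : hd K = ld K / 2 := rfl

lemma ld_ge (hn : 1 < Module.finrank ℚ K) : 1 ≤ ld K := by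
  have h := abs_discr_gt_two hn
  have h3 : (3 : ℝ) ≤ |(discr K : ℝ)| := by
    have : (3 : ℤ) ≤ |discr K| := h
    exact_mod_cast this
  rw [ld, Real.le_log_iff_exp_le (by linarith)]
  linarith [Real.exp_one_lt_d9]

lemma finrank_le (hn : 1 < Module.finrank ℚ K) : (Module.finrank ℚ K : ℝ) ≤ 4 * ld K := by
  have h := abs_discr_ge hn
  set n := Module.finrank ℚ K
  have h2 : (4 / 9 : ℝ) * (9 / 4) ^ n ≤ |(discr K : ℝ)| := by
    have h1 : ((4 / 9 : ℝ) * (3 * Real.pi / 4) ^ n) ≤ |(discr K : ℝ)| := by exact_mod_cast h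
    refine le_trans ?_ h1
    gcongr
    linarith [Real.pi_gt_three]
  have h3 := Real.log_le_log (by positivity) h2
  rw [Real.log_mul (by norm_num) (by positivity), Real.log_pow] at h3
  have h4 : Real.log (4 / 9) = - Real.log (9 / 4) := by rw [← Real.log_inv]; norm_num
  have h5 : (5 / 9 : ℝ) ≤ Real.log (9 / 4) := by
    have := Real.one_sub_inv_le_log_of_pos (show (0:ℝ) < 9 / 4 by norm_num)
    norm_num at this ⊢; linarith
  have hn2 : (2 : ℝ) ≤ n := by exact_mod_cast hn
  rw [h4] at h3
  have : ((n : ℝ) - 1) * Real.log (9 / 4) ≤ ld K := by rw [ld]; linarith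
  nlinarith

end

lemma mgf_le (s : ℝ) (hs : 1 < s) : ∃ E : ℝ, 0 ≤ E ∧ ∀ (K : Type) [Field K] [NumberField K],
    1 < Module.finrank ℚ K → mgf (fun z => z) (mu K) s ≤ Real.exp (E * ld K) := by
  obtain ⟨C, hC, h⟩ := Phi_exp_le s hs
  refine ⟨4 * Real.log C + s / 2, by have := Real.log_nonneg hC; positivity, ?_⟩
  intro K _ _ hn
  have h1 := h K
  rw [← lintegral_mu _ (mexp s), lint_of_integrable (mu K) (fun z => z) s (integrable_mu s hs), ENNReal.ofReal_le_ofReal_iff (by positivity)] at h1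
  refine h1.trans ?_
  have h2 : C ^ Module.finrank ℚ K = Real.exp (Module.finrank ℚ K * Real.log C) := by
    rw [mul_comm, ← Real.rpow_def_of_pos (by linarith), Real.rpow_natCast]
  rw [h2, ← Real.exp_add, hd_eq]
  apply Real.exp_le_exp.mpr
  nlinarith [mul_le_mul_of_nonneg_right (finrank_le hn) (Real.log_nonneg hC)]

section
variable {K : Type} [Field K] [NumberField K]

lemma low_mass (hn : 1 < Module.finrank ℚ K) (B : ℝ) (hB : 0 ≤ B) :
    ENNReal.ofReal (Real.exp (-(2 * B) - 26 * ld K)) ≤ ∫⁻ z in Iio (-B), ENNReal.ofReal (Real.exp (2 * z)) ∂(mu K) := by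
  have hD := ld_ge hn
  have hnD := finrank_le hn
  set n := Module.finrank ℚ K with hn'
  have hn0 : (0 : ℝ) < n := by exact_mod_cast (zero_lt_one.trans hn)
  set c : ℝ := -(B + 1 + hd K) / n with hc
  have hnc : n * c = -(B + 1 + hd K) := by rw [hc]; field_simp
  have hhd : 0 ≤ hd K := by rw [hd_eq]; linarith
  have hc0 : c ≤ 0 := by
    rw [hc]; apply div_nonpos_of_nonpos_of_nonneg <;> linarith
  have hmult : ∑ v : InfinitePlace K, (v.mult : ℝ) = n := by
    rw [hn', ← InfinitePlace.sum_mult_eq]; push_cast; rfl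
  set F : ℝ → ℝ≥0∞ := (Iio (-B)).indicator (fun z => ENNReal.ofReal (Real.exp (2 * z))) with hF
  rw [← lintegral_indicator measurableSet_Iio, lintegral_mu _ ((mexp 2).indicator measurableSet_Iio)]
  have ht : (⊤ : Ideal (𝓞 K)) ≠ ⊥ := top_ne_bot
  refine le_trans ?_ (ENNReal.le_tsum (f := fun I : NzI K => ∫⁻ u : InfinitePlace K → ℝ, f0 u * F (ell u + hd K - Real.log (Ideal.absNorm I.1))) ⟨⊤, ht⟩)
  have hvol : (volume : Measure (InfinitePlace K → ℝ)) (Icc (fun _ => c - 1) (fun _ => c)) = 1 := by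
    rw [Real.volume_Icc_pi]; simp
  calc ENNReal.ofReal (Real.exp (-(2 * B) - 26 * ld K))
      = ∫⁻ u : InfinitePlace K → ℝ in Icc (fun _ => c - 1) (fun _ => c), ENNReal.ofReal (Real.exp (-(2 * B) - 26 * ld K)) := by
        rw [setLIntegral_const, hvol, mul_one]
    _ ≤ ∫⁻ u : InfinitePlace K → ℝ in Icc (fun _ => c - 1) (fun _ => c), f0 u * F (ell u + hd K - Real.log (Ideal.absNorm (⊤ : Ideal (𝓞 K)))) := by
        refine setLIntegral_mono' measurableSet_Icc fun u hu => ?_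
        have hu1 : ∀ v, c - 1 ≤ u v := fun v => hu.1 v
        have hu2 : ∀ v, u v ≤ c := fun v => hu.2 v
        have e1 : ell u ≤ n * c := by
          rw [ell, ← hmult, Finset.sum_mul]
          exact Finset.sum_le_sum fun v _ => mul_le_mul_of_nonneg_left (hu2 v) (by positivity)
        have e2 : n * (c - 1) ≤ ell u := by
          rw [ell, ← hmult, Finset.sum_mul]
          exact Finset.sum_le_sum fun v _ => mul_le_mul_of_nonneg_left (hu1 v) (by positivity)
        have e3 : qf u 1 ≤ n := by
          rw [qf, ← hmult]
          refine Finset.sum_le_sum fun v _ => ?_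
          have : Real.exp (2 * u v) ≤ 1 := Real.exp_le_one_iff.mpr (by linarith [hu2 v])
          simp only [map_one, one_pow, mul_one]
          exact mul_le_of_le_one_right (by positivity) this
        have e4 : 0 ≤ qf u 1 := by
          rw [qf]; positivity
        rw [Ideal.absNorm_top, Nat.cast_one, Real.log_one, sub_zero, hF, indicator_of_mem (by simp only [mem_Iio]; linarith), f0,
          ← ENNReal.ofReal_mul (Real.exp_pos _).le, ← Real.exp_add]
        apply ENNReal.ofReal_le_ofReal
        apply Real.exp_le_exp.mpr
        have e5 : Real.pi * qf u 1 ≤ 4 * n := mul_le_mul Real.pi_le_four e3 e4 (by norm_num)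
        nlinarith
    _ ≤ _ := setLIntegral_le_lintegral _ _

end

theorem bounds : ∃ E : ℝ, 1 ≤ E ∧ ∀ (K : Type) [Field K] [NumberField K],
    1 < Module.finrank ℚ K → Real.exp (-(E * ld K)) ≤ Ares K ∧ mgf (fun z => z) (mu K) 2 ≤ Real.exp (E * ld K) ∧
      ∫ z in Ioi (E * ld K), Real.exp (2 * z) ∂(mu K) ≤ Ares K := by
  obtain ⟨E2, hE2, h2⟩ := mgf_le 2 (by norm_num)
  obtain ⟨E3, hE3, h3⟩ := mgf_le 3 (by norm_num)
  refine ⟨E2 + 54 + E3, by linarith, ?_⟩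
  intro K _ _ hn
  have hD := ld_ge hn
  have m2 := h2 K hn
  have m3 := h3 K hn
  set D := ld K
  have lowA : Real.exp (-((E2 + 54) * D)) ≤ Ares K := by
    set B := (E2 + 27) * D with hB
    have hB0 : 0 ≤ B := by positivity
    have hh := hecke_exp (K := K) 2 (-B) (by norm_num)
    have hlow := low_mass hn B hB0
    have htail : ∫⁻ z in Ioi B, ENNReal.ofReal (Real.exp ((1 - 2) * z)) ∂(mu K) ≤ ENNReal.ofReal (Real.exp (-(3 * B)) * Real.exp (E2 * D)) := by
      calc _ ≤ ∫⁻ z in Ioi B, ENNReal.ofReal (Real.exp (-(3 * B))) * ENNReal.ofReal (Real.exp (2 * z)) ∂(mu K) := by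
            refine setLIntegral_mono' measurableSet_Ioi fun z hz => ?_
            rw [← ENNReal.ofReal_mul (Real.exp_pos _).le, ← Real.exp_add]
            apply ENNReal.ofReal_le_ofReal
            apply Real.exp_le_exp.mpr
            have : B < z := hz
            linarith
        _ ≤ ∫⁻ z, ENNReal.ofReal (Real.exp (-(3 * B))) * ENNReal.ofReal (Real.exp (2 * z)) ∂(mu K) := setLIntegral_le_lintegral _ _
        _ = ENNReal.ofReal (Real.exp (-(3 * B))) * ENNReal.ofReal (mgf (fun z => z) (mu K) 2) := by
            rw [lintegral_const_mul _ (mexp 2), lint_of_integrable (mu K) (fun z => z) 2 (integrable_mu 2 (by norm_num))]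
        _ ≤ _ := by
            rw [← ENNReal.ofReal_mul (Real.exp_pos _).le]
            gcongr
    rw [neg_neg] at hh
    have hA := Ares_nonneg (K := K)
    have hfin : ENNReal.ofReal (Real.exp (-(2 * B) - 26 * D)) ≤ ENNReal.ofReal (Real.exp (-(3 * B)) * Real.exp (E2 * D) + Ares K * Real.exp (-B)) := by
      rw [ENNReal.ofReal_add (by positivity) (by positivity)]
      calc _ ≤ _ := hlow
        _ ≤ _ := le_self_add
        _ = _ := hh
        _ ≤ _ := by
          gcongr
          apply le_of_eq
          norm_num
    rw [ENNReal.ofReal_le_ofReal_iff (by positivity)] at hfin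
    have q1 : Real.exp (-(3 * B)) * Real.exp (E2 * D) = Real.exp (-(2 * B) - 26 * D) * Real.exp (-D) := by
      rw [← Real.exp_add, ← Real.exp_add]; congr 1; rw [hB]; ring
    have q2 : Real.exp (-D) ≤ 1 / 2 := by
      have : Real.exp (-D) ≤ Real.exp (-1) := Real.exp_le_exp.mpr (by linarith)
      have := Real.exp_neg_one_lt_d9; linarith
    have q3 : Real.exp (-(2 * B) - 26 * D) * Real.exp (-D) ≤ Ares K * Real.exp (-B) := by
      rw [q1] at hfin
      have := Real.exp_pos (-(2 * B) - 26 * D)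
      nlinarith
    have q4 : Real.exp (-(2 * B) - 26 * D) * Real.exp (-D) = Real.exp (-((E2 + 54) * D)) * Real.exp (-B) := by
      rw [← Real.exp_add, ← Real.exp_add]; congr 1; rw [hB]; ring
    rw [q4] at q3
    exact le_of_mul_le_mul_right q3 (Real.exp_pos _)
  refine ⟨le_trans (Real.exp_le_exp.mpr ?_) lowA, m2.trans (Real.exp_le_exp.mpr ?_), ?_⟩
  · nlinarith
  · nlinarith
  · set l := (E2 + 54 + E3) * D with hl
    calc ∫ z in Ioi l, Real.exp (2 * z) ∂(mu K) ≤ ∫ z in Ioi l, Real.exp (-l) * Real.exp (3 * z) ∂(mu K) := by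
          refine setIntegral_mono_on (integrable_mu 2 (by norm_num)).restrict ((integrable_mu 3 (by norm_num)).const_mul _).restrict measurableSet_Ioi ?_
          intro z hz
          have : l < z := hz
          rw [← Real.exp_add]
          apply Real.exp_le_exp.mpr; linarith
      _ ≤ ∫ z, Real.exp (-l) * Real.exp (3 * z) ∂(mu K) := by
          refine setIntegral_le_integral ((integrable_mu 3 (by norm_num)).const_mul _) (Filter.Eventually.of_forall fun z => ?_)
          simp only [Pi.zero_apply]; positivity
      _ = Real.exp (-l) * mgf (fun z => z) (mu K) 3 := by rw [integral_const_mul, mgf]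
      _ ≤ Real.exp (-l) * Real.exp (E3 * D) := by gcongr
      _ = Real.exp (-((E2 + 54) * D)) := by rw [← Real.exp_add, hl]; congr 1; ring
      _ ≤ _ := lowA
end DH
end PartP10

section PartP11
open MeasureTheory Set NumberField ProbabilityTheory
open scoped ENNReal Matrix nonZeroDivisors Topology
set_option linter.unusedSectionVars false
namespace DH

section
variable {K : Type} [Field K] [NumberField K]

lemma tail_int (l : ℝ) (hl : 0 ≤ l) : Integrable ((Ioi l).indicator fun z => Real.exp (2 * z)) ((mu K).restrict (Ici 0)) ∧
    ∫ z in Ici 0, (Ioi l).indicator (fun z => Real.exp (2 * z)) z ∂(mu K) = ∫ z in Ioi l, Real.exp (2 * z) ∂(mu K) := by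
  refine ⟨(integrable_mu_Ici 2).indicator measurableSet_Ioi, ?_⟩
  rw [setIntegral_indicator measurableSet_Ioi]
  congr 2
  ext z
  simp only [mem_inter_iff, mem_Ici, mem_Ioi, and_iff_right_iff_imp]
  intro h; linarith

lemma Qf_mono (a b : ℝ) (h : b ≤ a) : Qf K (1 - a) ≤ Qf K (1 - b) := by
  refine setIntegral_mono_on (integrable_mu_Ioi _) (integrable_mu_Ioi _) measurableSet_Ioi ?_
  intro z hz
  have : (0 : ℝ) < z := hz
  apply Real.exp_le_exp.mpr
  nlinarith

lemma Qf_nonneg (a : ℝ) : 0 ≤ Qf K a := integral_nonneg fun z => (Real.exp_pos _).le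

lemma Pf_diff (a b l : ℝ) (h : b ≤ a) (ha : a ≤ 1) (hl : 0 ≤ l)
    (ht : ∫ z in Ioi l, Real.exp (2 * z) ∂(mu K) ≤ Ares K) : Pf K a - Pf K b ≤ (a - b) * (l * Pf K a + Ares K) := by
  obtain ⟨t1, t2⟩ := tail_int (K := K) l hl
  have hab : 0 ≤ a - b := by linarith
  rw [Pf, Pf, ← integral_sub (integrable_mu_Ici _) (integrable_mu_Ici _)]
  calc _ ≤ ∫ z in Ici 0, (a - b) * (l * Real.exp (a * z) + (Ioi l).indicator (fun z => Real.exp (2 * z)) z) ∂(mu K) := by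
        refine setIntegral_mono_on ((integrable_mu_Ici _).sub (integrable_mu_Ici _))
          ((((integrable_mu_Ici a).const_mul l).add t1).const_mul (a - b)) measurableSet_Ici ?_
        intro z hz
        have hz : (0 : ℝ) ≤ z := hz
        have e1 : Real.exp (a * z) - Real.exp (b * z) ≤ (a - b) * (z * Real.exp (a * z)) := by
          have e2 : Real.exp (b * z) = Real.exp (a * z) * Real.exp (-((a - b) * z)) := by
            rw [← Real.exp_add]; congr 1; ring
          have e3 := Real.add_one_le_exp (-((a - b) * z))
          have e4 := Real.exp_pos (a * z)
          rw [e2]; nlinarith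
        refine e1.trans (mul_le_mul_of_nonneg_left ?_ hab)
        by_cases hzl : z ∈ Ioi l
        · rw [indicator_of_mem hzl]
          have e5 : z * Real.exp (a * z) ≤ Real.exp (2 * z) := by
            have : Real.exp (2 * z) = Real.exp z * Real.exp z := by rw [← Real.exp_add]; congr 1; ring
            rw [this]
            refine mul_le_mul ?_ (Real.exp_le_exp.mpr (by nlinarith)) (Real.exp_pos _).le (Real.exp_pos _).le
            linarith [Real.add_one_le_exp z]
          have := mul_nonneg hl (Real.exp_pos (a * z)).le
          linarith
        · rw [indicator_of_notMem hzl, add_zero]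
          exact mul_le_mul_of_nonneg_right (not_lt.mp hzl) (Real.exp_pos _).le
    _ = (a - b) * (l * (∫ z in Ici 0, Real.exp (a * z) ∂(mu K)) + ∫ z in Ioi l, Real.exp (2 * z) ∂(mu K)) := by
        rw [integral_const_mul, integral_add ((integrable_mu_Ici a).const_mul l) t1, t2, integral_const_mul]
    _ ≤ _ := by gcongr

lemma Pf_ratio (a b l : ℝ) (h : b ≤ a) (ha : a ≤ 1) (hl : 0 ≤ l)
    (ht : ∫ z in Ioi l, Real.exp (2 * z) ∂(mu K) ≤ Ares K) : Pf K a ≤ Real.exp ((a - b) * l) * Pf K b + Ares K := by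
  obtain ⟨t1, t2⟩ := tail_int (K := K) l hl
  rw [Pf, Pf]
  calc _ ≤ ∫ z in Ici 0, (Real.exp ((a - b) * l) * Real.exp (b * z) + (Ioi l).indicator (fun z => Real.exp (2 * z)) z) ∂(mu K) := by
        refine setIntegral_mono_on (integrable_mu_Ici _) (((integrable_mu_Ici b).const_mul _).add t1) measurableSet_Ici ?_
        intro z hz
        have hz : (0 : ℝ) ≤ z := hz
        by_cases hzl : z ∈ Ioi l
        · rw [indicator_of_mem hzl]
          have : Real.exp (a * z) ≤ Real.exp (2 * z) := Real.exp_le_exp.mpr (by nlinarith)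
          have : 0 < Real.exp ((a - b) * l) * Real.exp (b * z) := by positivity
          linarith
        · rw [indicator_of_notMem hzl, add_zero, ← Real.exp_add]
          apply Real.exp_le_exp.mpr
          have : z ≤ l := not_lt.mp hzl
          nlinarith
    _ = Real.exp ((a - b) * l) * (∫ z in Ici 0, Real.exp (b * z) ∂(mu K)) + ∫ z in Ioi l, Real.exp (2 * z) ∂(mu K) := by
        rw [integral_add ((integrable_mu_Ici b).const_mul _) t1, t2, integral_const_mul]
    _ ≤ _ := by gcongr

/-- lower bound for the smaller zero -/
lemma gap1 (a b l : ℝ) (hab : b < a) (ha : a < 1) (hb : 3 / 4 ≤ b) (hl : 1 ≤ l) (hA : 0 < Ares K)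
    (ht : ∫ z in Ioi l, Real.exp (2 * z) ∂(mu K) ≤ Ares K)
    (za : Ares K / (a * (1 - a)) = Pf K a + Qf K (1 - a)) (zb : Ares K / (b * (1 - b)) = Pf K b + Qf K (1 - b)) :
    1 ≤ 4 * l * (1 - b) := by
  have h1 := Pf_diff (K := K) a b l hab.le ha.le (by linarith) ht
  have h2 := Qf_mono (K := K) a b hab.le
  have h3 := Qf_nonneg (K := K) (1 - a)
  have ha0 : 0 < a := by linarith
  have ha1 : 0 < 1 - a := by linarith
  have hb0 : 0 < b := by linarith
  have hb1 : 0 < 1 - b := by linarith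
  have hd : 0 < a - b := by linarith
  have h4 : Ares K / (a * (1 - a)) - Ares K / (b * (1 - b)) ≤ (a - b) * (l * (Ares K / (a * (1 - a))) + Ares K) := by
    have : (a - b) * (l * Pf K a + Ares K) ≤ (a - b) * (l * (Ares K / (a * (1 - a))) + Ares K) := by
      have : Pf K a ≤ Ares K / (a * (1 - a)) := by linarith
      gcongr
    linarith
  have h5 : Ares K / (a * (1 - a)) - Ares K / (b * (1 - b)) = (Ares K * (a - b)) * ((a + b - 1) / (a * (1 - a) * (b * (1 - b)))) := by
    field_simp; ring
  have h6 : (a - b) * (l * (Ares K / (a * (1 - a))) + Ares K) = (Ares K * (a - b)) * (l / (a * (1 - a)) + 1) := by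
    field_simp
  rw [h5, h6] at h4
  have h7 := le_of_mul_le_mul_left h4 (by positivity)
  rw [div_le_iff₀ (by positivity)] at h7
  have h8 : (l / (a * (1 - a)) + 1) * (a * (1 - a) * (b * (1 - b))) = (l + a * (1 - a)) * (b * (1 - b)) := by
    field_simp
  rw [h8] at h7
  have h9 : (l + a * (1 - a)) * (b * (1 - b)) ≤ (2 * l) * (1 - b) := by
    have : a * (1 - a) ≤ 1 := by nlinarith
    have h10 : b * (1 - b) ≤ 1 - b := by nlinarith
    have : 0 < b * (1 - b) := by positivity
    calc _ ≤ (2 * l) * (b * (1 - b)) := by gcongr; linarith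
      _ ≤ _ := by gcongr
  linarith

/-- repulsion -/
lemma gap2 (a b l : ℝ) (hab : b < a) (ha : a < 1) (hb : 3 / 4 ≤ b) (hl : 1 ≤ l) (hA : 0 < Ares K)
    (ht : ∫ z in Ioi l, Real.exp (2 * z) ∂(mu K) ≤ Ares K)
    (za : Ares K / (a * (1 - a)) = Pf K a + Qf K (1 - a)) (zb : Ares K / (b * (1 - b)) = Pf K b + Qf K (1 - b)) :
    Real.log (1 / (12 * l * (1 - a))) ≤ (1 - b) * l := by
  have g1 := gap1 a b l hab ha hb hl hA ht za zb
  have h1 := Pf_ratio (K := K) a b l hab.le ha.le (by linarith) ht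
  have h2 := Qf_mono (K := K) a b hab.le
  have h3 := Qf_nonneg (K := K) (1 - b)
  have ha0 : 0 < a := by linarith
  have ha1 : 0 < 1 - a := by linarith
  have hb0 : 0 < b := by linarith
  have hb1 : 0 < 1 - b := by linarith
  have hl0 : 0 < l := by linarith
  set X := Real.exp ((a - b) * l) with hX
  have hX1 : 1 ≤ X := Real.one_le_exp (by nlinarith)
  have h4 : Ares K / (a * (1 - a)) ≤ X * (Ares K / (b * (1 - b))) + Ares K := by
    rw [za, zb]; nlinarith
  have h5 : Ares K / (a * (1 - a)) = Ares K * (1 / (a * (1 - a))) := by ring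
  have h6 : X * (Ares K / (b * (1 - b))) + Ares K = Ares K * (X / (b * (1 - b)) + 1) := by ring
  rw [h5, h6] at h4
  have h7 := le_of_mul_le_mul_left h4 hA
  have h8 : 1 / (1 - a) ≤ 3 * X / (1 - b) := by
    have e1 : 1 / (1 - a) ≤ 1 / (a * (1 - a)) := by
      apply one_div_le_one_div_of_le (by positivity); nlinarith
    have e2 : X / (b * (1 - b)) ≤ 2 * X / (1 - b) := by
      rw [div_le_div_iff₀ (by positivity) hb1]
      have : 0 < X * (1 - b) := by positivity
      nlinarith
    have e3 : 1 ≤ X / (1 - b) := by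
      rw [le_div_iff₀ hb1]; linarith
    have e4 : 3 * X / (1 - b) = 2 * X / (1 - b) + X / (1 - b) := by ring
    linarith
  have h9 : 3 * X / (1 - b) ≤ 12 * l * X := by
    rw [div_le_iff₀ hb1]; nlinarith
  have h10 : 1 / (12 * l * (1 - a)) ≤ Real.exp ((1 - b) * l) := by
    have e1 : X ≤ Real.exp ((1 - b) * l) := Real.exp_le_exp.mpr (by nlinarith)
    refine le_trans ?_ e1
    have := h8.trans h9
    rw [div_le_iff₀ ha1] at this
    rw [div_le_iff₀ (by positivity)]
    linarith
  calc _ ≤ Real.log (Real.exp ((1 - b) * l)) := Real.log_le_log (by positivity) h10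
    _ = _ := Real.log_exp _

lemma zero_lower (E : ℝ) (hE : 1 ≤ E) (hn : 1 < Module.finrank ℚ K) (β : ℝ) (h0 : 0 < β) (h1 : β < 1)
    (hA : Real.exp (-(E * ld K)) ≤ Ares K) (hm : mgf (fun z => z) (mu K) 2 ≤ Real.exp (E * ld K))
    (z : Ares K / (β * (1 - β)) = Pf K β + Qf K (1 - β)) : Real.exp (-(3 * E * ld K)) ≤ 1 - β := by
  have hD := ld_ge hn
  have i2 := integrable_mu (K := K) 2 (by norm_num)
  have hp : Pf K β ≤ mgf (fun z => z) (mu K) 2 := by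
    calc _ ≤ ∫ z in Ici 0, Real.exp (2 * z) ∂(mu K) := by
          refine setIntegral_mono_on (integrable_mu_Ici _) (integrable_mu_Ici _) measurableSet_Ici ?_
          intro z hz
          have hz : (0 : ℝ) ≤ z := hz
          exact Real.exp_le_exp.mpr (by nlinarith)
      _ ≤ _ := setIntegral_le_integral i2 (Filter.Eventually.of_forall fun z => (Real.exp_pos _).le)
  have hq : Qf K (1 - β) ≤ mgf (fun z => z) (mu K) 2 := by
    calc _ ≤ ∫ z in Ioi 0, Real.exp (2 * z) ∂(mu K) := by
          refine setIntegral_mono_on (integrable_mu_Ioi _) (integrable_mu_Ioi _) measurableSet_Ioi ?_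
          intro z hz
          have hz : (0 : ℝ) < z := hz
          exact Real.exp_le_exp.mpr (by nlinarith)
      _ ≤ _ := setIntegral_le_integral i2 (Filter.Eventually.of_forall fun z => (Real.exp_pos _).le)
  have hb1 : 0 < 1 - β := by linarith
  have hA0 : 0 < Ares K := (Real.exp_pos _).trans_le hA
  have h2 : Ares K ≤ 2 * Real.exp (E * ld K) * (1 - β) := by
    have e1 : Ares K / (β * (1 - β)) ≤ 2 * Real.exp (E * ld K) := by linarith
    rw [div_le_iff₀ (by positivity)] at e1
    have : β * (1 - β) ≤ 1 - β := by nlinarith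
    have := mul_le_mul_of_nonneg_left this (show 0 ≤ 2 * Real.exp (E * ld K) by positivity)
    linarith
  have h3 : 2 ≤ Real.exp (E * ld K) := by
    have := Real.add_one_le_exp (E * ld K)
    nlinarith
  set Y := Real.exp (E * ld K) with hY
  have hY0 : 0 < Y := Real.exp_pos _
  have e1 : Real.exp (-(E * ld K)) = Y⁻¹ := Real.exp_neg _
  have e2 : Real.exp (-(3 * E * ld K)) = Y⁻¹ * Y⁻¹ * Y⁻¹ := by
    rw [← e1, ← Real.exp_add, ← Real.exp_add]; congr 1; ring
  rw [e2]
  have h4 : Y⁻¹ ≤ Y * Y * (1 - β) := by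
    rw [e1] at hA
    have : 2 * Y * (1 - β) ≤ Y * Y * (1 - β) := by gcongr
    linarith
  calc Y⁻¹ * Y⁻¹ * Y⁻¹ ≤ Y⁻¹ * Y⁻¹ * (Y * Y * (1 - β)) := by gcongr
    _ = 1 - β := by field_simp
end

theorem final : ∃ c₁ : ℝ, 0 < c₁ ∧ ∃ c₂ : ℝ, 0 < c₂ ∧
      ∀ (L : Type) [Field L] [NumberField L],
        1 < Module.finrank ℚ L →
        ∀ ζ : ℂ → ℂ,
          (∀ s : ℂ, s ≠ 1 → AnalyticAt ℂ ζ s) →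
          (∀ s : ℂ, 1 < s.re →
            ζ s = ∑' I : {I : Ideal (𝓞 L) // I ≠ ⊥}, (Ideal.absNorm I.1 : ℂ) ^ (-s)) →
        ∀ β₁ : ℝ, 0 < β₁ → β₁ < 1 → ζ β₁ = 0 →
        ∀ β' : ℝ, 0 < β' → β' < 1 → ζ β' = 0 → β' ≠ β₁ →
          β' ≤ 1 - c₂ * Real.log (c₁ / ((1 - β₁) * ld L)) / ld L := by
  obtain ⟨E, hE, hb⟩ := bounds
  have hE0 : 0 < E := by linarith
  refine ⟨1 / (12 * E), by positivity, 1 / (12 * E), by positivity, ?_⟩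
  intro L _ _ hn ζ hζ hζ2 β₁ p0 p1 pz β' q0 q1 qz hne
  obtain ⟨hA, hm, ht⟩ := hb L hn
  have hD := ld_ge hn
  have z1 := zero_identity ζ hζ hζ2 β₁ p0 p1 pz
  have z2 := zero_identity ζ hζ hζ2 β' q0 q1 qz
  have hA0 : 0 < Ares L := (Real.exp_pos _).trans_le hA
  have hlow := zero_lower E hE hn β₁ p0 p1 hA hm z1
  set D := ld L with hDdef
  have hD0 : 0 < D := by linarith
  have h1 : 0 < 1 - β₁ := by linarith
  have h2 : 0 < 1 - β' := by linarith
  have hl : 1 ≤ E * D := by nlinarith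
  set lg := Real.log (1 / (12 * E) / ((1 - β₁) * D)) with hlg
  suffices hs : lg ≤ 12 * E * D * (1 - β') by
    have : 1 / (12 * E) * lg / D ≤ 1 - β' := by
      rw [div_le_iff₀ hD0, div_mul_eq_mul_div, one_mul, div_le_iff₀ (by positivity)]
      linarith
    linarith
  have hpos : 0 < 12 * E * D * (1 - β') := by positivity
  have triv : 1 ≤ 12 * E * ((1 - β₁) * D) → lg ≤ 12 * E * D * (1 - β') := by
    intro h
    have : lg ≤ 0 := by
      apply Real.log_nonpos (by positivity)
      rw [div_div, div_le_one (by positivity)]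
      exact h
    linarith
  by_cases hq : 3 / 4 ≤ β'
  · rcases lt_or_gt_of_ne hne with hlt | hgt
    · have g := gap2 β₁ β' (E * D) hlt p1 hq hl hA0 ht z1 z2
      have e : 1 / (12 * (E * D) * (1 - β₁)) = 1 / (12 * E) / ((1 - β₁) * D) := by
        rw [div_div]; congr 1; ring
      rw [e] at g
      have : (1 - β') * (E * D) ≤ 12 * E * D * (1 - β') := by nlinarith
      linarith
    · apply triv
      by_cases hp : 3 / 4 ≤ β₁
      · have g := gap1 β' β₁ (E * D) hgt q1 hp hl hA0 ht z2 z1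
        nlinarith
      · have : 1 / 4 ≤ 1 - β₁ := by linarith
        nlinarith
  · have h3 : 1 / 4 ≤ 1 - β' := by linarith
    have h4 : lg ≤ 3 * E * D := by
      have : 1 / (12 * E) / ((1 - β₁) * D) ≤ Real.exp (3 * E * D) := by
        rw [div_div, div_le_iff₀ (by positivity)]
        have e1 : 1 ≤ Real.exp (3 * E * D) * (1 - β₁) := by
          have := mul_le_mul_of_nonneg_left hlow (Real.exp_pos (3 * E * D)).le
          rwa [← Real.exp_add, add_neg_cancel, Real.exp_zero] at this
        calc (1 : ℝ) ≤ Real.exp (3 * E * D) * (1 - β₁) := e1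
          _ ≤ Real.exp (3 * E * D) * (1 - β₁) * (12 * (E * D)) := le_mul_of_one_le_right (by positivity) (by linarith)
          _ = _ := by ring
      calc lg ≤ Real.log (Real.exp (3 * E * D)) := Real.log_le_log (by positivity) this
        _ = _ := Real.log_exp _
    have : 3 * E * D ≤ 12 * E * D * (1 - β') := by
      have : 0 < E * D := by positivity
      nlinarith
    linarith
end DH
end PartP11


open NumberField

/-- **Deuring–Heilbronn phenomenon for real zeros.**
For every `η ∈ (0,1]` there are constants `c₁'', c₂'' > 0`, depending only on `η`, such
that: if `L ≠ ℚ` is a number field with Dedekind zeta function `ζ`, `β₁` is an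
exceptional real zero of `ζ`, and `β' ∈ (0,1)` is a real zero of `ζ` with `β' ≠ β₁`,
then either `β' ≤ 1 - η` or
`β' ≤ 1 - c₂'' · log(c₁'' / ((1-β₁)·log d_L)) / log d_L`. -/
theorem deuring_heilbronn_real_zeros (η : ℝ) (hη0 : 0 < η) (hη1 : η ≤ 1) :
    ∃ c₁'' : ℝ, 0 < c₁'' ∧ ∃ c₂'' : ℝ, 0 < c₂'' ∧
      ∀ (L : Type) [Field L] [NumberField L],
        1 < Module.finrank ℚ L →
        ∀ ζ : ℂ → ℂ,
          (∀ s : ℂ, s ≠ 1 → AnalyticAt ℂ ζ s) →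
          (∀ s : ℂ, 1 < s.re →
            ζ s = ∑' I : {I : Ideal (𝓞 L) // I ≠ ⊥}, (Ideal.absNorm I.1 : ℂ) ^ (-s)) →
        ∀ β₁ : ℝ, (0 < β₁ ∧ β₁ < 1 ∧ ζ β₁ = 0 ∧
            1 - 1 / (29.57 * (Real.log |(NumberField.discr L : ℝ)| +
              (Module.finrank ℚ L : ℝ) * Real.log 2)) ≤ β₁) →
        ∀ β' : ℝ, (0 < β' ∧ β' < 1 ∧ ζ β' = 0 ∧ β' ≠ β₁) →
          β' ≤ 1 - η ∨
          β' ≤ 1 - c₂'' *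
            Real.log (c₁'' / ((1 - β₁) * Real.log |(NumberField.discr L : ℝ)|)) /
            Real.log |(NumberField.discr L : ℝ)| := by
  obtain ⟨c₁, h1, c₂, h2, h⟩ := DH.final
  refine ⟨c₁, h1, c₂, h2, ?_⟩
  intro L _ _ hn ζ hζ hζ2 β₁ hβ₁ β' hβ'
  exact Or.inr (h L hn ζ hζ hζ2 β₁ hβ₁.1 hβ₁.2.1 hβ₁.2.2.1 β' hβ'.1 hβ'.2.1 hβ'.2.2.1 hβ'.2.2.2)
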